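/- Let K = convexHull ℝ S be a convex polytope in E = EuclideanSpace ℝ (Fin 3) (S finite, interior K nonempty). If there exists a simple closed geodesic in frontier K of length L, then there exist infinitely many simple closed geodesics in frontier K, all of length L, with pairwise distinct images. -/

import Mathlib

open scoped ENNReal

/-- A simple closed geodesic in a closed set `F ⊆ EuclideanSpace ℝ (Fin 3)`:
a continuous map `γ : ℝ → E`, periodic with period 1, injective on `[0,1)`,
with image in `F`, of finite positive length (total variation on `[0,1]`),
that is locally shortest among continuous paths in `F`. -/
def IsSimpleClosedGeodesicIn (F : Set (EuclideanSpace ℝ (Fin 3)))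
    (γ : ℝ → EuclideanSpace ℝ (Fin 3)) : Prop :=
  Continuous γ ∧
  Function.Periodic γ 1 ∧
  Set.InjOn γ (Set.Ico (0 : ℝ) 1) ∧
  (∀ t : ℝ, γ t ∈ F) ∧
  0 < eVariationOn γ (Set.Icc 0 1) ∧
  eVariationOn γ (Set.Icc 0 1) < ⊤ ∧
  ∀ t : ℝ, ∃ ε > (0 : ℝ), ∀ s₁ s₂ : ℝ,
    s₁ ∈ Set.Ioo (t - ε) (t + ε) → s₂ ∈ Set.Ioo (t - ε) (t + ε) → s₁ ≤ s₂ →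
    ∀ (a b : ℝ) (c : ℝ → EuclideanSpace ℝ (Fin 3)), a ≤ b →
      ContinuousOn c (Set.Icc a b) → c a = γ s₁ → c b = γ s₂ →
      (∀ x ∈ Set.Icc a b, c x ∈ F) →
      eVariationOn γ (Set.Icc s₁ s₂) ≤ eVariationOn c (Set.Icc a b)

/-- Fourier–Motzkin elimination: finitely generated cones are finite intersections of
half-spaces. -/
theorem exists_finset_dual_mem_span_nnreal_iff {V : Type*} [AddCommGroup V] [Module ℝ V]
    [FiniteDimensional ℝ V] {S : Set V} (hS : S.Finite) :
    ∃ T : Finset (V →ₗ[ℝ] ℝ), ∀ x, x ∈ Submodule.span NNReal S ↔ ∀ f ∈ T, f x ≤ 0 := by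
  classical
  induction S, hS using Set.Finite.induction_on with
  | empty =>
    let b := Module.finBasis ℝ V
    refine ⟨Finset.univ.image b.coord ∪ Finset.univ.image (fun i => -b.coord i), fun x => ?_⟩
    simp only [Submodule.span_empty, Submodule.mem_bot]
    constructor
    · rintro rfl; simp
    · intro h
      apply b.ext_elem
      intro i
      have h1 := h (b.coord i) (by simp)
      have h2 := h (-b.coord i) (by simp)
      simp at h1 h2
      simpa using le_antisymm h1 h2
  | @insert a S _ _ ih =>
    obtain ⟨T, hT⟩ := ih
    refine ⟨T.filter (fun f => f a ≤ 0) ∪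
      ((T.filter (fun f => 0 < f a)) ×ˢ (T.filter (fun f => f a < 0))).image
        (fun q => q.1 a • q.2 - q.2 a • q.1), fun x => ?_⟩
    rw [Submodule.mem_span_insert]
    constructor
    · rintro ⟨t, z, hz, rfl⟩ f hf
      rw [hT] at hz
      have ht : (0 : ℝ) ≤ t := t.2
      rw [NNReal.smul_def]
      simp only [Finset.mem_union, Finset.mem_filter, Finset.mem_image, Finset.mem_product,
        Prod.exists] at hf
      rcases hf with ⟨hfT, hfa⟩ | ⟨f₁, f₂, ⟨⟨h1, h1a⟩, h2, h2a⟩, rfl⟩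
      · have := hz f hfT
        simp only [map_add, map_smul, smul_eq_mul]
        nlinarith
      · have e1 := hz f₁ h1
        have e2 := hz f₂ h2
        simp only [map_add, map_smul, smul_eq_mul, LinearMap.sub_apply, LinearMap.smul_apply]
        nlinarith
    · intro h
      set A : Finset ℝ := insert 0 ((T.filter (fun f => 0 < f a)).image (fun f => f x / f a))
        with hA
      have hne : A.Nonempty := ⟨0, by simp [hA]⟩
      have ht0 : 0 ≤ A.max' hne := A.le_max' 0 (by simp [hA])
      have hlow : ∀ f ∈ T, 0 < f a → f x ≤ A.max' hne * f a := by
        intro f hf hfa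
        rw [← div_le_iff₀ hfa]
        refine A.le_max' _ ?_
        simp only [hA, Finset.mem_insert, Finset.mem_image, Finset.mem_filter]
        exact Or.inr ⟨f, ⟨hf, hfa⟩, rfl⟩
      have hup : ∀ g ∈ T, g a < 0 → g x ≤ A.max' hne * g a := by
        intro g hg hga
        rw [← le_div_iff_of_neg hga]
        refine A.max'_le hne _ ?_
        intro y hy
        simp only [hA, Finset.mem_insert, Finset.mem_image, Finset.mem_filter] at hy
        rcases hy with rfl | ⟨f, ⟨hf, hfa⟩, rfl⟩
        · have := h g (by simp [hg, hga.le])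
          exact div_nonneg_of_nonpos this hga.le
        · have := h (f a • g - g a • f) (by
            simp only [Finset.mem_union, Finset.mem_filter, Finset.mem_image, Finset.mem_product,
              Prod.exists]
            exact Or.inr ⟨f, g, ⟨⟨hf, hfa⟩, hg, hga⟩, rfl⟩)
          simp only [LinearMap.sub_apply, LinearMap.smul_apply, smul_eq_mul] at this
          rw [div_le_iff₀ hfa, div_mul_eq_mul_div, le_div_iff_of_neg hga]
          linarith
      obtain ⟨t, ht⟩ : ∃ t : NNReal, (t : ℝ) = A.max' hne := ⟨⟨_, ht0⟩, rfl⟩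
      refine ⟨t, x - A.max' hne • a, ?_, ?_⟩
      · rw [hT]
        intro f hf
        simp only [map_sub, map_smul, smul_eq_mul]
        rcases lt_trichotomy (f a) 0 with h0 | h0 | h0
        · linarith [hup f hf h0]
        · have := h f (by simp [hf, h0])
          rw [h0]; linarith
        · linarith [hlow f hf h0]
      · rw [NNReal.smul_def, ht]
        simp

open Pointwise in
/-- A point lies in a convex hull iff its lift at height `1` lies in the cone over the lifts. -/
theorem mem_convexHull_iff_one_mk_mem_span {V : Type*} [AddCommGroup V] [Module ℝ V]
    {S : Set V} (x : V) :
    x ∈ convexHull ℝ S ↔ ((1 : ℝ), x) ∈ Submodule.span NNReal ((fun y => ((1 : ℝ), y)) '' S) := by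
  constructor
  · intro hx
    have hsub : convexHull ℝ S ⊆
        {y | ((1 : ℝ), y) ∈ Submodule.span NNReal ((fun y => ((1 : ℝ), y)) '' S)} := by
      refine convexHull_min (fun y hy => Submodule.subset_span ⟨y, hy, rfl⟩) ?_
      intro y hy z hz a b ha hb hab
      lift a to NNReal using ha
      lift b to NNReal using hb
      have h1 := Submodule.smul_mem _ a (Set.mem_ofPred.1 hy)
      have h2 := Submodule.smul_mem _ b (Set.mem_ofPred.1 hz)
      have h3 := Submodule.add_mem _ h1 h2
      simpa [NNReal.smul_def, hab] using h3
    exact hsub hx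
  · intro hx
    have key : ∀ q ∈ Submodule.span NNReal ((fun y => ((1 : ℝ), y)) '' S),
        0 ≤ q.1 ∧ (q = 0 ∨ ∃ y ∈ convexHull ℝ S, q.2 = q.1 • y) := by
      intro q hq
      induction hq using Submodule.span_induction with
      | mem q hq =>
        obtain ⟨y, hy, rfl⟩ := hq
        exact ⟨zero_le_one, Or.inr ⟨y, subset_convexHull ℝ S hy, by simp⟩⟩
      | zero => exact ⟨le_rfl, Or.inl rfl⟩
      | add p q _ _ hp hq =>
        refine ⟨add_nonneg hp.1 hq.1, ?_⟩
        rcases hp with ⟨hp1, rfl | ⟨y, hy, hpy⟩⟩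
        · simpa using hq.2
        rcases hq with ⟨hq1, rfl | ⟨z, hz, hqz⟩⟩
        · simpa using Or.inr ⟨y, hy, hpy⟩
        right
        have : p.2 + q.2 ∈ (p.1 + q.1) • convexHull ℝ S := by
          rw [(convex_convexHull ℝ S).add_smul hp1 hq1]
          exact Set.add_mem_add ⟨y, hy, hpy.symm⟩ ⟨z, hz, hqz.symm⟩
        obtain ⟨w, hw, hw'⟩ := this
        exact ⟨w, hw, hw'.symm⟩
      | smul c q _ hq =>
        refine ⟨mul_nonneg c.2 hq.1, ?_⟩
        rcases hq with ⟨_, rfl | ⟨y, hy, hpy⟩⟩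
        · left; simp
        · right
          refine ⟨y, hy, ?_⟩
          simp [NNReal.smul_def, hpy, mul_smul]
    rcases (key _ hx).2 with h | ⟨y, hy, h⟩
    · simp at h
    · simp at h; rwa [h]

/-- A full-dimensional polytope is the intersection of finitely many half-spaces, all of
whose boundaries avoid the interior. -/
theorem exists_finset_halfspaces {V : Type*} [NormedAddCommGroup V] [InnerProductSpace ℝ V]
    [FiniteDimensional ℝ V] {S : Set V} (hS : S.Finite)
    (hint : (interior (convexHull ℝ S)).Nonempty) :
    ∃ T : Finset (V × ℝ), (∀ i ∈ T, i.1 ≠ 0) ∧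
      ∀ x, x ∈ convexHull ℝ S ↔ ∀ i ∈ T, inner ℝ i.1 x ≤ i.2 := by
  classical
  obtain ⟨T, hT⟩ := exists_finset_dual_mem_span_nnreal_iff
    (hS.image (fun y : V => ((1 : ℝ), y)))
  let g : (ℝ × V →ₗ[ℝ] ℝ) → V × ℝ := fun f =>
    ((InnerProductSpace.toDual ℝ V).symm
      (LinearMap.toContinuousLinearMap (f ∘ₗ LinearMap.inr ℝ ℝ V)), - f (1, 0))
  have hg : ∀ f x, inner ℝ (g f).1 x ≤ (g f).2 ↔ f (1, x) ≤ 0 := by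
    intro f x
    have : f (1, x) = f (1, 0) + f (0, x) := by rw [← map_add]; simp
    simp only [g, InnerProductSpace.toDual_symm_apply, this]
    simp only [LinearMap.coe_toContinuousLinearMap', LinearMap.coe_comp, Function.comp_apply,
      LinearMap.inr_apply]
    constructor <;> intro h <;> linarith
  refine ⟨(T.image g).filter (fun i => i.1 ≠ 0), fun i hi => (Finset.mem_filter.1 hi).2, ?_⟩
  have hmem : ∀ x, x ∈ convexHull ℝ S ↔ ∀ f ∈ T, inner ℝ (g f).1 x ≤ (g f).2 := by
    intro x
    rw [mem_convexHull_iff_one_mk_mem_span, hT]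
    simp only [hg]
  intro x
  rw [hmem]
  constructor
  · intro h i hi
    obtain ⟨f, hf, rfl⟩ := Finset.mem_image.1 (Finset.mem_filter.1 hi).1
    exact h f hf
  · intro h f hf
    by_cases h0 : (g f).1 = 0
    · obtain ⟨y, hy⟩ := hint
      have := (hmem y).1 (interior_subset hy) f hf
      rw [h0, inner_zero_left] at this ⊢
      exact this
    · exact h _ (Finset.mem_filter.2 ⟨Finset.mem_image_of_mem g hf, h0⟩)

theorem inner_lt_of_mem_interior {V : Type*} [NormedAddCommGroup V] [InnerProductSpace ℝ V]
    {K : Set V} {n : V} {b : ℝ} (hn : n ≠ 0) (hK : ∀ x ∈ K, inner ℝ n x ≤ b) {x : V}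
    (hx : x ∈ interior K) : inner ℝ n x < b := by
  obtain ⟨ε, hε, hb⟩ := Metric.isOpen_iff.1 isOpen_interior x hx
  have hn' : 0 < ‖n‖ := norm_pos_iff.2 hn
  have hmem : x + (ε / (2 * ‖n‖)) • n ∈ K := by
    apply interior_subset
    apply hb
    rw [Metric.mem_ball, dist_eq_norm, add_sub_cancel_left, norm_smul, Real.norm_eq_abs,
      abs_of_pos (by positivity)]
    field_simp
    linarith
  have := hK _ hmem
  rw [inner_add_right, inner_smul_right, real_inner_self_eq_norm_sq] at this
  have h2 : 0 < ε / (2 * ‖n‖) * ‖n‖ ^ 2 := by positivity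
  linarith

section Polyhedron

variable {V : Type*} [NormedAddCommGroup V] [InnerProductSpace ℝ V] {K : Set V}
  {T : Finset (V × ℝ)}

theorem mem_interior_iff_of_halfspaces (hT0 : ∀ i ∈ T, i.1 ≠ 0)
    (hT : ∀ x, x ∈ K ↔ ∀ i ∈ T, inner ℝ i.1 x ≤ i.2) (x : V) :
    x ∈ interior K ↔ ∀ i ∈ T, inner ℝ i.1 x < i.2 := by
  constructor
  · intro hx i hi
    exact inner_lt_of_mem_interior (hT0 i hi) (fun y hy => (hT y).1 hy i hi) hx
  · intro hx
    have hopen : IsOpen {y : V | ∀ i ∈ T, inner ℝ i.1 y < i.2} := by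
      simp only [Set.ofPred_forall]
      refine isOpen_biInter_finset fun i _ => ?_
      exact isOpen_lt (by fun_prop) continuous_const
    exact interior_maximal (fun y hy => (hT y).2 fun i hi => (hy i hi).le) hopen hx

theorem isClosed_of_halfspaces (hT : ∀ x, x ∈ K ↔ ∀ i ∈ T, inner ℝ i.1 x ≤ i.2) :
    IsClosed K := by
  have : K = ⋂ i ∈ T, {x | inner ℝ i.1 x ≤ i.2} := by
    ext x; simp [hT]
  rw [this]
  exact isClosed_biInter fun i _ => isClosed_le (by fun_prop) continuous_const

theorem mem_frontier_iff_of_halfspaces (hT0 : ∀ i ∈ T, i.1 ≠ 0)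
    (hT : ∀ x, x ∈ K ↔ ∀ i ∈ T, inner ℝ i.1 x ≤ i.2) (x : V) :
    x ∈ frontier K ↔ (∀ i ∈ T, inner ℝ i.1 x ≤ i.2) ∧ ∃ i ∈ T, inner ℝ i.1 x = i.2 := by
  rw [(isClosed_of_halfspaces hT).frontier_eq, Set.mem_sdiff,
    mem_interior_iff_of_halfspaces hT0 hT, hT]
  refine and_congr_right fun h => ?_
  push Not
  exact exists_congr fun i => and_congr_right fun hi =>
    ⟨fun hle => le_antisymm (h i hi) hle, fun heq => heq.ge⟩

/-- Near a point, only the constraints active at that point matter. -/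
theorem exists_radius_of_active (x : V) : ∃ r > 0, ∀ y, dist y x < r →
    ∀ i ∈ T, inner ℝ i.1 x < i.2 → inner ℝ i.1 y < i.2 := by
  have : ∀ᶠ y in nhds x, ∀ i ∈ T, inner ℝ i.1 x < i.2 → inner ℝ i.1 y < i.2 := by
    rw [Filter.eventually_all_finset]
    intro i _
    by_cases h : inner ℝ i.1 x < i.2
    · have : ContinuousAt (fun y : V => inner ℝ i.1 y) x := by fun_prop
      filter_upwards [this.eventually_lt_const h] with y hy _ using hy
    · exact Filter.Eventually.of_forall fun y h' => absurd h' h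
  obtain ⟨r, hr, h⟩ := Metric.eventually_nhds_iff.1 this
  exact ⟨r, hr, fun y hy => h hy⟩

end Polyhedron

section PathDist

variable {α : Type*} [MetricSpace α]

/-- `c` restricted to `[a, b]` is a path in `F` from `x` to `y`. -/
structure IsPathIn (F : Set α) (x y : α) (a b : ℝ) (c : ℝ → α) : Prop where
  le : a ≤ b
  cont : ContinuousOn c (Set.Icc a b)
  source : c a = x
  target : c b = y
  mem : ∀ t ∈ Set.Icc a b, c t ∈ F

/-- The intrinsic (path-length) distance in `F`. -/
noncomputable def pathDist (F : Set α) (x y : α) : ℝ≥0∞ :=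
  ⨅ (a : ℝ) (b : ℝ) (c : ℝ → α) (_ : IsPathIn F x y a b c), eVariationOn c (Set.Icc a b)

variable {F : Set α} {x y z : α}

theorem pathDist_le {a b : ℝ} {c : ℝ → α} (h : IsPathIn F x y a b c) :
    pathDist F x y ≤ eVariationOn c (Set.Icc a b) :=
  iInf_le_of_le a <| iInf_le_of_le b <| iInf_le_of_le c <| iInf_le_of_le h le_rfl

theorem le_pathDist_iff {d : ℝ≥0∞} : d ≤ pathDist F x y ↔
    ∀ a b c, IsPathIn F x y a b c → d ≤ eVariationOn c (Set.Icc a b) := by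
  simp only [pathDist, le_iInf_iff]

theorem exists_lt_of_pathDist_lt {d : ℝ≥0∞} (h : pathDist F x y < d) :
    ∃ a b c, IsPathIn F x y a b c ∧ eVariationOn c (Set.Icc a b) < d := by
  simp only [pathDist, iInf_lt_iff] at h
  obtain ⟨a, b, c, hc, h⟩ := h
  exact ⟨a, b, c, hc, h⟩

theorem edist_le_pathDist : edist x y ≤ pathDist F x y := by
  rw [le_pathDist_iff]
  intro a b c h
  have := eVariationOn.edist_le c (s := Set.Icc a b) (Set.left_mem_Icc.2 h.le)
    (Set.right_mem_Icc.2 h.le)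
  rwa [h.source, h.target] at this

theorem pathDist_self (hx : x ∈ F) : pathDist F x x = 0 := by
  have h : IsPathIn F x x 0 0 (fun _ => x) :=
    ⟨le_rfl, continuousOn_const, rfl, rfl, fun _ _ => hx⟩
  refine le_antisymm ((pathDist_le h).trans ?_) bot_le
  rw [eVariationOn.subsingleton _ (by simp)]

theorem pathDist_triangle : pathDist F x z ≤ pathDist F x y + pathDist F y z := by
  refine ENNReal.le_of_forall_pos_le_add fun ε hε hfin => ?_
  have hxy : pathDist F x y ≠ ⊤ := fun h => by simp [h] at hfin
  have hyz : pathDist F y z ≠ ⊤ := fun h => by simp [h] at hfin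
  have hε2 : (ε / 2 : ℝ≥0∞) ≠ 0 := by simp [hε.ne']
  obtain ⟨a, b, c, hc, hcl⟩ := exists_lt_of_pathDist_lt (ENNReal.lt_add_right hxy hε2)
  obtain ⟨a', b', c', hc', hcl'⟩ := exists_lt_of_pathDist_lt (ENNReal.lt_add_right hyz hε2)
  set f : ℝ → α := fun t => if t ≤ b then c t else c' (t - b + a') with hf
  have h1 : Set.EqOn f c (Set.Icc a b) := fun t ht => by simp [hf, ht.2]
  have h2 : Set.EqOn f (fun t => c' (t - b + a')) (Set.Icc b (b + (b' - a'))) := by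
    intro t ht
    rcases ht.1.eq_or_lt with rfl | h
    · simp [hf, hc.target, hc'.source]
    · simp [hf, not_le.2 h]
  have hbb : b ≤ b + (b' - a') := by linarith [hc'.le]
  have hmaps : ∀ t ∈ Set.Icc b (b + (b' - a')), t - b + a' ∈ Set.Icc a' b' := by
    intro t ht; constructor <;> linarith [ht.1, ht.2]
  have hpath : IsPathIn F x z a (b + (b' - a')) f := by
    refine ⟨hc.le.trans hbb, ?_, ?_, ?_, ?_⟩
    · rw [← Set.Icc_union_Icc_eq_Icc hc.le hbb]
      refine ContinuousOn.union_of_isClosed (hc.cont.congr h1) (ContinuousOn.congr ?_ h2)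
        isClosed_Icc isClosed_Icc
      exact hc'.cont.comp (by fun_prop) hmaps
    · rw [h1 (Set.left_mem_Icc.2 hc.le), hc.source]
    · rw [h2 (Set.right_mem_Icc.2 hbb)]
      simp [hc'.target]
    · intro t ht
      rcases le_total t b with h | h
      · rw [h1 ⟨ht.1, h⟩]; exact hc.mem t ⟨ht.1, h⟩
      · rw [h2 ⟨h, ht.2⟩]; exact hc'.mem _ (hmaps t ⟨h, ht.2⟩)
  have hadd := eVariationOn.Icc_add_Icc f (s := Set.univ) hc.le hbb (Set.mem_univ b)
  simp only [Set.univ_inter] at hadd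
  calc pathDist F x z ≤ _ := pathDist_le hpath
    _ = eVariationOn c (Set.Icc a b)
        + eVariationOn (c' ∘ fun t => t - b + a') (Set.Icc b (b + (b' - a'))) := by
      rw [← hadd, eVariationOn.congr h1, eVariationOn.congr h2]; rfl
    _ ≤ eVariationOn c (Set.Icc a b) + eVariationOn c' (Set.Icc a' b') := by
      gcongr
      exact eVariationOn.comp_le_of_monotoneOn _ _
        (fun s _ t _ hst => by simpa using hst) hmaps
    _ ≤ (pathDist F x y + ε / 2) + (pathDist F y z + ε / 2) := by gcongr
    _ = pathDist F x y + pathDist F y z + ε := by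
      rw [add_add_add_comm, ENNReal.add_halves]

theorem LipschitzOnWith.eVariationOn_Icc_le {C : NNReal} {f : ℝ → α} {a b : ℝ}
    (h : LipschitzOnWith C f (Set.Icc a b)) :
    eVariationOn f (Set.Icc a b) ≤ C * ENNReal.ofReal (b - a) := by
  have h1 := h.comp_eVariationOn_le (g := id) (s := Set.Icc a b) (Set.mapsTo_id _)
  refine h1.trans ?_
  gcongr
  rcases le_or_gt a b with hab | hab
  · have := (monotoneOn_id (s := Set.Icc a b)).eVariationOn_eq (Set.left_mem_Icc.2 hab)
      (Set.right_mem_Icc.2 hab)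
    rw [Set.inter_self] at this
    exact this.le
  · simp [Set.Icc_eq_empty (not_le.2 hab), eVariationOn.subsingleton]

theorem pathDist_le_of_lipschitzOnWith_segment {V : Type*} [NormedAddCommGroup V]
    [NormedSpace ℝ V] {f : V → α} {v w : V} (hf : LipschitzOnWith 1 f (segment ℝ v w))
    (hF : ∀ u ∈ segment ℝ v w, f u ∈ F) : pathDist F (f v) (f w) ≤ edist v w := by
  have hmaps : Set.MapsTo (AffineMap.lineMap v w : ℝ → V) (Set.Icc 0 1) (segment ℝ v w) := by
    intro t ht
    rw [segment_eq_image_lineMap]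
    exact ⟨t, ht, rfl⟩
  have hline : LipschitzOnWith (nndist v w) (AffineMap.lineMap v w : ℝ → V) (Set.Icc 0 1) :=
    (lipschitzWith_lineMap v w).lipschitzOnWith
  have hlip := hf.comp hline hmaps
  have hpath : IsPathIn F (f v) (f w) 0 1 (f ∘ (AffineMap.lineMap v w : ℝ → V)) :=
    ⟨zero_le_one, hlip.continuousOn, by simp, by simp, fun t ht => hF _ (hmaps ht)⟩
  refine (pathDist_le hpath).trans (hlip.eVariationOn_Icc_le.trans ?_)
  rw [sub_zero, ENNReal.ofReal_one, mul_one, one_mul, edist_nndist]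

end PathDist

section Projection

variable {V : Type*} [NormedAddCommGroup V] [InnerProductSpace ℝ V]

/-- The nearest-point projection to a closed convex body is `1`-Lipschitz and maps the
complement of the interior to the frontier. -/
theorem exists_lipschitz_retraction [CompleteSpace V] {K : Set V} (hK : IsClosed K)
    (hconv : Convex ℝ K) (hne : K.Nonempty) :
    ∃ π : V → V, LipschitzWith 1 π ∧ (∀ x ∈ K, π x = x) ∧ ∀ x ∉ interior K, π x ∈ frontier K := by
  have h := fun x => exists_norm_eq_iInf_of_complete_convex hne hK.isComplete hconv x
  choose π hπK hπ using h
  have hπ' : ∀ x, ∀ w ∈ K, inner ℝ (x - π x) (w - π x) ≤ 0 := fun x =>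
    (norm_eq_iInf_iff_real_inner_le_zero hconv (hπK x)).1 (hπ x)
  have hfix : ∀ x ∈ K, π x = x := by
    intro x hx
    have := hπ' x x hx
    rw [real_inner_self_eq_norm_sq] at this
    have h0 : ‖x - π x‖ = 0 := by nlinarith [norm_nonneg (x - π x)]
    exact (sub_eq_zero.1 (norm_eq_zero.1 h0)).symm
  refine ⟨π, LipschitzWith.of_dist_le_mul fun x y => ?_, hfix, fun x hx => ?_⟩
  · have h1 := hπ' x (π y) (hπK y)
    have h2 := hπ' y (π x) (hπK x)
    have h3 : ‖π x - π y‖ ^ 2 ≤ inner ℝ (x - y) (π x - π y) := by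
      rw [← real_inner_self_eq_norm_sq]
      have e1 : inner ℝ (x - y) (π x - π y) - inner ℝ (π x - π y) (π x - π y)
          = - inner ℝ (x - π x) (π y - π x) - inner ℝ (y - π y) (π x - π y) := by
        simp only [inner_sub_left, inner_sub_right]; ring
      linarith
    have h4 := real_inner_le_norm (x - y) (π x - π y)
    rw [NNReal.coe_one, one_mul, dist_eq_norm, dist_eq_norm]
    by_contra! hlt
    have hpos : 0 < ‖π x - π y‖ := (norm_nonneg _).trans_lt hlt
    nlinarith
  · by_cases hxK : x ∈ K
    · rw [hfix x hxK, hK.frontier_eq]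
      exact ⟨hxK, hx⟩
    · rw [hK.frontier_eq]
      refine ⟨hπK x, fun hint => ?_⟩
      have hne : x - π x ≠ 0 := fun h => hxK (by rw [sub_eq_zero.1 h]; exact hπK x)
      have := inner_lt_of_mem_interior (b := inner ℝ (x - π x) (π x)) hne (fun w hw => by
        have := hπ' x w hw
        rw [inner_sub_right] at this
        linarith) hint
      exact lt_irrefl _ this

end Projection

section Shortcut

variable {V : Type*} [NormedAddCommGroup V] [InnerProductSpace ℝ V]

theorem norm_sub_smul_le {d : V} (hd : d ≠ 0) (x : V) (ε : ℝ) :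
    ‖d - ε • x‖ ≤ ‖d‖ - ε * (inner ℝ d x / ‖d‖) + ε ^ 2 * (‖x‖ ^ 2 / (2 * ‖d‖)) := by
  have hd' : 0 < ‖d‖ := norm_pos_iff.2 hd
  have h1 : ‖d - ε • x‖ ^ 2 = ‖d‖ ^ 2 - 2 * (ε * inner ℝ d x) + ε ^ 2 * ‖x‖ ^ 2 := by
    rw [norm_sub_sq_real, inner_smul_right, norm_smul, mul_pow, Real.norm_eq_abs, sq_abs]
  have h2 : ‖d‖ - ε * (inner ℝ d x / ‖d‖) + ε ^ 2 * (‖x‖ ^ 2 / (2 * ‖d‖))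
      = (‖d‖ ^ 2 + ‖d - ε • x‖ ^ 2) / (2 * ‖d‖) := by
    rw [h1]; field_simp; ring
  rw [h2, le_div_iff₀ (by positivity)]
  nlinarith [sq_nonneg (‖d‖ - ‖d - ε • x‖)]

/-- First variation: a broken path through the apex can be shortened. -/
theorem exists_shorter_polyline {d₁ d₂ x₁ x₂ : V} (h₁ : d₁ ≠ 0) (h₂ : d₂ ≠ 0)
    (h : ‖x₁ - x₂‖ < inner ℝ d₁ x₁ / ‖d₁‖ + inner ℝ d₂ x₂ / ‖d₂‖) :
    ∃ ε : ℝ, 0 < ε ∧ ‖d₁ - ε • x₁‖ + ‖ε • x₁ - ε • x₂‖ + ‖ε • x₂ - d₂‖ < ‖d₁‖ + ‖d₂‖ := by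
  set k := inner ℝ d₁ x₁ / ‖d₁‖ + inner ℝ d₂ x₂ / ‖d₂‖ - ‖x₁ - x₂‖ with hk
  set C := ‖x₁‖ ^ 2 / (2 * ‖d₁‖) + ‖x₂‖ ^ 2 / (2 * ‖d₂‖) with hC
  have hkpos : 0 < k := by linarith
  have hC0 : 0 ≤ C := by positivity
  refine ⟨k / (C + 1), by positivity, ?_⟩
  set ε := k / (C + 1) with hε
  have hεpos : 0 < ε := by positivity
  have e1 := norm_sub_smul_le h₁ x₁ ε
  have e2 := norm_sub_smul_le h₂ x₂ ε
  rw [norm_sub_rev] at e2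
  have e3 : ‖ε • x₁ - ε • x₂‖ = ε * ‖x₁ - x₂‖ := by
    rw [← smul_sub, norm_smul, Real.norm_eq_abs, abs_of_pos hεpos]
  have e4 : ε * (C + 1) = k := by rw [hε]; field_simp
  have e5 : ε * C < k := by nlinarith
  have e6 : ε * (ε * C) < ε * k := mul_lt_mul_of_pos_left e5 hεpos
  rw [e3]
  have e7 : ε * k = ε * (inner ℝ d₁ x₁ / ‖d₁‖) + ε * (inner ℝ d₂ x₂ / ‖d₂‖)
      - ε * ‖x₁ - x₂‖ := by rw [hk]; ring
  have e8 : ε * (ε * C) = ε ^ 2 * (‖x₁‖ ^ 2 / (2 * ‖d₁‖)) + ε ^ 2 * (‖x₂‖ ^ 2 / (2 * ‖d₂‖)) := by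
    rw [hC]; ring
  linarith

theorem add_div_neg_mul_self {a b : ℝ} (hb : b ≠ 0) : a + a / -b * b = 0 := by
  rw [div_neg, neg_mul, div_mul_cancel₀ _ hb, add_neg_cancel]

theorem norm_smul_sub_smul_lt {u v : V} (hu : ‖u‖ = 1) (hv : ‖v‖ = 1) (huv : -1 < inner ℝ u v)
    {a b : ℝ} (ha : 0 < a) (hb : 0 < b) : ‖a • u - b • v‖ < a + b := by
  have h : ‖a • u - b • v‖ ^ 2 = a ^ 2 - 2 * (a * b * inner ℝ u v) + b ^ 2 := by
    rw [norm_sub_sq_real, norm_smul, norm_smul, inner_smul_left, inner_smul_right, hu, hv]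
    simp; ring
  have : ‖a • u - b • v‖ ^ 2 < (a + b) ^ 2 := by
    rw [h]; nlinarith [mul_pos ha hb]
  exact lt_of_pow_lt_pow_left₀ 2 (by positivity) this

theorem exists_ne_zero_inner_eq_zero [FiniteDimensional ℝ V] (hdim : 2 < Module.finrank ℝ V)
    (m n : V) : ∃ e : V, e ≠ 0 ∧ inner ℝ m e = 0 ∧ inner ℝ n e = 0 := by
  have h : (Submodule.span ℝ {m, n})ᗮ ≠ ⊥ := by
    intro hbot
    rw [Submodule.orthogonal_eq_bot_iff] at hbot
    have h1 : Module.finrank ℝ (Submodule.span ℝ ({m, n} : Set V)) ≤ 2 := by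
      classical
      have := finrank_span_finset_le_card (R := ℝ) ({m, n} : Finset V)
      rw [Finset.coe_pair] at this
      exact this.trans Finset.card_le_two
    rw [hbot, finrank_top] at h1
    omega
  obtain ⟨e, he, he0⟩ := Submodule.exists_mem_ne_zero_of_ne_bot h
  refine ⟨e, he0, ?_, ?_⟩
  · exact he m (Submodule.subset_span (by simp))
  · exact he n (Submodule.subset_span (by simp))

/-- The data of a shortcut around the apex of a pointed cone `{v | ∀ n ∈ A, ⟪n, v⟫ ≤ 0}`. -/
theorem exists_shortcut_directions [FiniteDimensional ℝ V] (hdim : 2 < Module.finrank ℝ V)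
    {A : Set V} (hA : ∀ e, (∀ n ∈ A, inner ℝ n e = 0) → e = 0) {d₁ d₂ m₁ m₂ : V}
    (h₁ : d₁ ≠ 0) (h₂ : d₂ ≠ 0) (hd₁ : ∀ n ∈ A, inner ℝ n d₁ ≤ 0)
    (hd₂ : ∀ n ∈ A, inner ℝ n d₂ ≤ 0) (hm₁ : m₁ ∈ A) (hm₂ : m₂ ∈ A)
    (hmd₁ : inner ℝ m₁ d₁ = 0) (hmd₂ : inner ℝ m₂ d₂ = 0) :
    ∃ x₁ x₂ : V, ‖x₁ - x₂‖ < inner ℝ d₁ x₁ / ‖d₁‖ + inner ℝ d₂ x₂ / ‖d₂‖ ∧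
      (∃ n ∈ A, inner ℝ n d₁ = 0 ∧ inner ℝ n x₁ = 0) ∧
      (∃ n ∈ A, inner ℝ n x₁ = 0 ∧ inner ℝ n x₂ = 0) ∧
      (∃ n ∈ A, inner ℝ n x₂ = 0 ∧ inner ℝ n d₂ = 0) := by
  have hp₁ : 0 < ‖d₁‖ := norm_pos_iff.2 h₁
  have hp₂ : 0 < ‖d₂‖ := norm_pos_iff.2 h₂
  obtain ⟨u, hu⟩ : ∃ u, u = ‖d₁‖⁻¹ • d₁ := ⟨_, rfl⟩
  obtain ⟨v, hv⟩ : ∃ v, v = ‖d₂‖⁻¹ • d₂ := ⟨_, rfl⟩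
  have hu1 : ‖u‖ = 1 := by rw [hu, norm_smul, norm_inv, norm_norm, inv_mul_cancel₀ hp₁.ne']
  have hv1 : ‖v‖ = 1 := by rw [hv, norm_smul, norm_inv, norm_norm, inv_mul_cancel₀ hp₂.ne']
  have hdu : d₁ = ‖d₁‖ • u := by rw [hu, smul_inv_smul₀ hp₁.ne']
  have hdv : d₂ = ‖d₂‖ • v := by rw [hv, smul_inv_smul₀ hp₂.ne']
  have hiu : ∀ x, inner ℝ d₁ x / ‖d₁‖ = inner ℝ u x := by
    intro x
    rw [hu, inner_smul_left]; simp; field_simp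
  have hiv : ∀ x, inner ℝ d₂ x / ‖d₂‖ = inner ℝ v x := by
    intro x
    rw [hv, inner_smul_left]; simp; field_simp
  have hnu : ∀ n, inner ℝ n d₁ = ‖d₁‖ * inner ℝ n u := by
    intro n
    conv_lhs => rw [hdu, inner_smul_right]
  have hnv : ∀ n, inner ℝ n d₂ = ‖d₂‖ * inner ℝ n v := by
    intro n
    conv_lhs => rw [hdv, inner_smul_right]
  simp only [hnu, hnv, mul_nonpos_iff_pos_imp_nonpos, hp₁, hp₂, true_imp_iff] at hd₁ hd₂
  replace hd₁ : ∀ n ∈ A, inner ℝ n u ≤ 0 := fun n hn => (hd₁ n hn).1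
  replace hd₂ : ∀ n ∈ A, inner ℝ n v ≤ 0 := fun n hn => (hd₂ n hn).1
  simp only [hnu, hnv, mul_eq_zero, hp₁.ne', hp₂.ne', false_or] at hmd₁ hmd₂
  simp only [hiu, hiv, hnu, hnv, mul_eq_zero, hp₁.ne', hp₂.ne', false_or]
  have huu : inner ℝ u u = (1 : ℝ) := by rw [real_inner_self_eq_norm_sq, hu1]; norm_num
  have hvv : inner ℝ v v = (1 : ℝ) := by rw [real_inner_self_eq_norm_sq, hv1]; norm_num
  have huv : -1 < inner ℝ u v := by
    refine lt_of_le_of_ne ?_ fun h => ?_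
    · have := (abs_le.1 (abs_real_inner_le_norm u v)).1
      rwa [hu1, hv1, one_mul] at this
    · have huv := (inner_eq_neg_one_iff_of_norm_eq_one hu1 hv1).1 h.symm
      have hv0 : v = 0 := by
        refine hA v fun n hn => le_antisymm (hd₂ n hn) ?_
        have := hd₁ n hn
        rw [huv, inner_neg_right] at this
        linarith
      rw [hv0, norm_zero] at hv1
      exact zero_ne_one hv1
  have hvu : -1 < inner ℝ v u := by rwa [real_inner_comm]
  obtain ⟨e, he0, he₁, he₂, hpos⟩ : ∃ e : V, e ≠ 0 ∧ inner ℝ m₁ e = 0 ∧ inner ℝ m₂ e = 0 ∧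
      0 ≤ inner ℝ u e + inner ℝ v e := by
    obtain ⟨e, he0, he₁, he₂⟩ := exists_ne_zero_inner_eq_zero hdim m₁ m₂
    rcases le_total 0 (inner ℝ u e + inner ℝ v e) with h | h
    · exact ⟨e, he0, he₁, he₂, h⟩
    · exact ⟨-e, neg_ne_zero.2 he0, by simp [he₁], by simp [he₂], by
        rw [inner_neg_right, inner_neg_right]; linarith⟩
  rcases hpos.eq_or_lt with hzero | hpos
  swap
  · exact ⟨e, e, by simpa using hpos, ⟨m₁, hm₁, hmd₁, he₁⟩, ⟨m₁, hm₁, he₁, he₁⟩,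
      ⟨m₂, hm₂, he₂, hmd₂⟩⟩
  obtain ⟨e, n, he₁, he₂, hzero, hn, hne⟩ : ∃ e n : V, inner ℝ m₁ e = 0 ∧ inner ℝ m₂ e = 0 ∧
      0 = inner ℝ u e + inner ℝ v e ∧ n ∈ A ∧ 0 < inner ℝ n e := by
    obtain ⟨n, hn, hne⟩ : ∃ n ∈ A, inner ℝ n e ≠ 0 := by
      by_contra! h
      exact he0 (hA e h)
    rcases hne.lt_or_gt with h | h
    · exact ⟨-e, n, by simp [he₁], by simp [he₂], by
        rw [inner_neg_right, inner_neg_right]; linarith, hn, by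
        rw [inner_neg_right]; linarith⟩
    · exact ⟨e, n, he₁, he₂, hzero, hn, h⟩
  rcases (hd₁ n hn).eq_or_lt with hu0 | hu0 <;> rcases (hd₂ n hn).eq_or_lt with hv0 | hv0
  · refine ⟨u, v, ?_, ⟨n, hn, hu0, hu0⟩, ⟨n, hn, hu0, hv0⟩, ⟨n, hn, hv0, hv0⟩⟩
    have := norm_smul_sub_smul_lt hu1 hv1 huv one_pos one_pos
    rw [one_smul, one_smul] at this
    rwa [huu, hvv]
  · have hσ : 0 < inner ℝ n e / (- inner ℝ n v) := by apply div_pos hne; linarith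
    set σ := inner ℝ n e / (- inner ℝ n v) with hσdef
    have hx : inner ℝ n (e + σ • v) = 0 := by
      rw [inner_add_right, inner_smul_right, hσdef]; exact add_div_neg_mul_self hv0.ne
    have hm : inner ℝ m₂ (e + σ • v) = 0 := by
      rw [inner_add_right, inner_smul_right, he₂, hmd₂]; ring
    refine ⟨e + σ • v, e + σ • v, ?_, ⟨n, hn, hu0, hx⟩, ⟨n, hn, hx, hx⟩, ⟨m₂, hm₂, hm, hmd₂⟩⟩
    rw [sub_self, norm_zero, inner_add_right, inner_add_right, inner_smul_right,
      inner_smul_right, hvv]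
    nlinarith
  · have hσ : 0 < inner ℝ n e / (- inner ℝ n u) := by apply div_pos hne; linarith
    set σ := inner ℝ n e / (- inner ℝ n u) with hσdef
    have hx : inner ℝ n (e + σ • u) = 0 := by
      rw [inner_add_right, inner_smul_right, hσdef]; exact add_div_neg_mul_self hu0.ne
    have hm : inner ℝ m₁ (e + σ • u) = 0 := by
      rw [inner_add_right, inner_smul_right, he₁, hmd₁]; ring
    refine ⟨e + σ • u, e + σ • u, ?_, ⟨m₁, hm₁, hmd₁, hm⟩, ⟨n, hn, hx, hx⟩, ⟨n, hn, hx, hv0⟩⟩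
    rw [sub_self, norm_zero, inner_add_right, inner_add_right, inner_smul_right,
      inner_smul_right, huu]
    nlinarith
  · have hσ : 0 < inner ℝ n e / (- inner ℝ n u) := by apply div_pos hne; linarith
    set σ := inner ℝ n e / (- inner ℝ n u) with hσdef
    have hτ : 0 < inner ℝ n e / (- inner ℝ n v) := by apply div_pos hne; linarith
    set τ := inner ℝ n e / (- inner ℝ n v) with hτdef
    have hx : inner ℝ n (e + σ • u) = 0 := by
      rw [inner_add_right, inner_smul_right, hσdef]; exact add_div_neg_mul_self hu0.ne
    have hy : inner ℝ n (e + τ • v) = 0 := by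
      rw [inner_add_right, inner_smul_right, hτdef]; exact add_div_neg_mul_self hv0.ne
    have hm : inner ℝ m₁ (e + σ • u) = 0 := by
      rw [inner_add_right, inner_smul_right, he₁, hmd₁]; ring
    have hm' : inner ℝ m₂ (e + τ • v) = 0 := by
      rw [inner_add_right, inner_smul_right, he₂, hmd₂]; ring
    refine ⟨e + σ • u, e + τ • v, ?_, ⟨m₁, hm₁, hmd₁, hm⟩, ⟨n, hn, hx, hy⟩, ⟨m₂, hm₂, hm', hmd₂⟩⟩
    have := norm_smul_sub_smul_lt hu1 hv1 huv hσ hτ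
    rw [add_sub_add_left_eq_sub, inner_add_right, inner_add_right, inner_smul_right,
      inner_smul_right, hvv, huu]
    linarith


theorem convex_of_halfspaces {K : Set V} {T : Finset (V × ℝ)}
    (hT : ∀ x, x ∈ K ↔ ∀ i ∈ T, inner ℝ i.1 x ≤ i.2) :
    Convex ℝ K := by
  intro x hx y hy a b ha hb hab
  rw [hT] at hx hy ⊢
  intro i hi
  rw [inner_add_right, inner_smul_right, inner_smul_right]
  have h1 := mul_le_mul_of_nonneg_left (hx i hi) ha
  have h2 := mul_le_mul_of_nonneg_left (hy i hi) hb
  have h3 : a * i.2 + b * i.2 = i.2 := by rw [← add_mul, hab, one_mul]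
  linarith

end Shortcut

section Vertex

variable {V : Type*} [NormedAddCommGroup V] [InnerProductSpace ℝ V] [FiniteDimensional ℝ V]
  {K : Set V} {T : Finset (V × ℝ)}

/-- Near a vertex, the path through the vertex is never shortest. -/
theorem exists_radius_pathDist_lt_of_vertex (hdim : 2 < Module.finrank ℝ V)
    (hT0 : ∀ i ∈ T, i.1 ≠ 0) (hT : ∀ x, x ∈ K ↔ ∀ i ∈ T, inner ℝ i.1 x ≤ i.2) {p : V}
    (hp : p ∈ frontier K)
    (hvert : ∀ e, (∀ i ∈ T, inner ℝ i.1 p = i.2 → inner ℝ i.1 e = 0) → e = 0) :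
    ∃ r > 0, ∀ x ∈ frontier K, ∀ y ∈ frontier K, dist x p < r → dist y p < r → x ≠ p → y ≠ p →
      pathDist (frontier K) x y < edist x p + edist p y := by
  obtain ⟨r, hr, hact⟩ := exists_radius_of_active (T := T) p
  refine ⟨r, hr, fun x hx y hy hxr hyr hxp hyp => ?_⟩
  have hclosed := isClosed_of_halfspaces hT
  have hfr := mem_frontier_iff_of_halfspaces hT0 hT
  obtain ⟨π, hπlip, hπfix, hπfr⟩ := exists_lipschitz_retraction hclosed (convex_of_halfspaces hT)
    ⟨p, hclosed.frontier_subset hp⟩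
  have hseg : ∀ a b : V, (∃ i ∈ T, inner ℝ i.1 a = i.2 ∧ inner ℝ i.1 b = i.2) →
      pathDist (frontier K) (π a) (π b) ≤ edist a b := by
    rintro a b ⟨i, hi, ha, hb⟩
    refine pathDist_le_of_lipschitzOnWith_segment hπlip.lipschitzOnWith ?_
    rintro _ ⟨s, t, hs, ht, hst, rfl⟩
    apply hπfr
    rw [mem_interior_iff_of_halfspaces hT0 hT]
    push Not
    refine ⟨i, hi, ?_⟩
    rw [inner_add_right, inner_smul_right, inner_smul_right, ha, hb, ← add_mul, hst, one_mul]
  have hxK := (hT x).1 (hclosed.frontier_subset hx)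
  have hyK := (hT y).1 (hclosed.frontier_subset hy)
  have hpK := (hT p).1 (hclosed.frontier_subset hp)
  have hactive : ∀ z, dist z p < r → z ∈ frontier K →
      ∃ i ∈ T, inner ℝ i.1 p = i.2 ∧ inner ℝ i.1 (z - p) = 0 := by
    intro z hz hzF
    obtain ⟨i, hi, hiz⟩ := ((hfr z).1 hzF).2
    have : inner ℝ i.1 p = i.2 := by
      refine le_antisymm (hpK i hi) (not_lt.1 fun h => ?_)
      exact (hact z hz i hi h).ne hiz
    exact ⟨i, hi, this, by rw [inner_sub_right, this, hiz, sub_self]⟩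
  obtain ⟨i₁, hi₁, hp₁, hx₁⟩ := hactive x hxr hx
  obtain ⟨i₂, hi₂, hp₂, hy₂⟩ := hactive y hyr hy
  obtain ⟨x₁, x₂, hlt, ⟨_, ⟨j₁, ⟨hj₁, hjp₁⟩, rfl⟩, ha, ha'⟩, ⟨_, ⟨j₂, ⟨hj₂, hjp₂⟩, rfl⟩, hb, hb'⟩,
      ⟨_, ⟨j₃, ⟨hj₃, hjp₃⟩, rfl⟩, hc, hc'⟩⟩ :=
    exists_shortcut_directions hdim
      (A := Prod.fst '' {i : V × ℝ | i ∈ T ∧ inner ℝ i.1 p = i.2})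
      (fun e he => hvert e fun i hi hip => he i.1 ⟨i, ⟨hi, hip⟩, rfl⟩)
      (sub_ne_zero.2 hxp) (sub_ne_zero.2 hyp)
      (by
        rintro _ ⟨i, ⟨hi, hip⟩, rfl⟩
        rw [inner_sub_right, hip]; linarith [hxK i hi])
      (by
        rintro _ ⟨i, ⟨hi, hip⟩, rfl⟩
        rw [inner_sub_right, hip]; linarith [hyK i hi])
      ⟨i₁, ⟨hi₁, hp₁⟩, rfl⟩ ⟨i₂, ⟨hi₂, hp₂⟩, rfl⟩ hx₁ hy₂
  obtain ⟨ε, hε, hlen⟩ := exists_shorter_polyline (sub_ne_zero.2 hxp) (sub_ne_zero.2 hyp) hlt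
  have hmove : ∀ j : V × ℝ, inner ℝ j.1 p = j.2 → ∀ w, inner ℝ j.1 w = 0 →
      inner ℝ j.1 (p + ε • w) = j.2 := by
    intro j hj w hw
    rw [inner_add_right, inner_smul_right, hw, hj, mul_zero, add_zero]
  have hend : ∀ j : V × ℝ, inner ℝ j.1 p = j.2 → ∀ w, inner ℝ j.1 (w - p) = 0 →
      inner ℝ j.1 w = j.2 := by
    intro j hj w hw
    rw [inner_sub_right, hj] at hw
    linarith
  have s1 := hseg x (p + ε • x₁) ⟨j₁, hj₁, hend _ hjp₁ _ ha, hmove _ hjp₁ _ ha'⟩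
  have s2 := hseg (p + ε • x₁) (p + ε • x₂) ⟨j₂, hj₂, hmove _ hjp₂ _ hb, hmove _ hjp₂ _ hb'⟩
  have s3 := hseg (p + ε • x₂) y ⟨j₃, hj₃, hmove _ hjp₃ _ hc, hend _ hjp₃ _ hc'⟩
  rw [hπfix x (hclosed.frontier_subset hx)] at s1
  rw [hπfix y (hclosed.frontier_subset hy)] at s3
  calc pathDist (frontier K) x y
      ≤ edist x (p + ε • x₁) + edist (p + ε • x₁) (p + ε • x₂) + edist (p + ε • x₂) y :=
        pathDist_triangle.trans (add_le_add (pathDist_triangle.trans (add_le_add s1 s2)) s3)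
    _ < edist x p + edist p y := by
      simp only [edist_dist]
      rw [← ENNReal.ofReal_add dist_nonneg dist_nonneg,
        ← ENNReal.ofReal_add (by positivity) dist_nonneg,
        ← ENNReal.ofReal_add dist_nonneg dist_nonneg, ENNReal.ofReal_lt_ofReal_iff_of_nonneg
          (by positivity)]
      rw [dist_comm p y]
      simp only [dist_eq_norm]
      rw [← sub_sub, add_sub_add_left_eq_sub, show p + ε • x₂ - y = ε • x₂ - (y - p) by abel]
      exact hlen

end Vertex

section Fold

variable {V : Type*} [NormedAddCommGroup V] [InnerProductSpace ℝ V]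

/-- The plane folded along its real axis: the closed upper half-plane is spanned by `e`, `a`,
the closed lower half-plane by `e`, `b`. -/
noncomputable def foldMap (p e a b : V) (ζ : ℂ) : V :=
  p + ζ.re • e + ζ.im • (if 0 ≤ ζ.im then a else b)

variable {p e a b : V}

theorem foldMap_of_nonneg {ζ : ℂ} (h : 0 ≤ ζ.im) :
    foldMap p e a b ζ = p + ζ.re • e + ζ.im • a := by
  rw [foldMap, if_pos h]

theorem foldMap_of_nonpos {ζ : ℂ} (h : ζ.im ≤ 0) :
    foldMap p e a b ζ = p + ζ.re • e + ζ.im • b := by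
  rcases h.eq_or_lt with h | h
  · simp [foldMap, h]
  · rw [foldMap, if_neg (not_le.2 h)]

theorem foldMap_zero : foldMap p e a b 0 = p := by simp [foldMap]

theorem norm_smul_add_smul_sq {e a : V} (he : ‖e‖ = 1) (ha : ‖a‖ = 1) (hea : inner ℝ e a = 0)
    (s t : ℝ) : ‖s • e + t • a‖ ^ 2 = s ^ 2 + t ^ 2 := by
  rw [norm_add_sq_real, norm_smul, norm_smul, inner_smul_left, inner_smul_right, hea, he, ha]
  simp

theorem norm_smul_add_smul {e a : V} (he : ‖e‖ = 1) (ha : ‖a‖ = 1) (hea : inner ℝ e a = 0)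
    (ζ : ℂ) : ‖ζ.re • e + ζ.im • a‖ = ‖ζ‖ := by
  have h := norm_smul_add_smul_sq he ha hea ζ.re ζ.im
  have h2 : ‖ζ‖ ^ 2 = ζ.re ^ 2 + ζ.im ^ 2 := by
    rw [← Complex.normSq_eq_norm_sq, Complex.normSq_apply]; ring
  rw [← h2] at h
  exact (pow_left_inj₀ (norm_nonneg _) (norm_nonneg _) two_ne_zero).1 h

theorem dist_foldMap_of_nonneg (he : ‖e‖ = 1) (ha : ‖a‖ = 1) (hea : inner ℝ e a = 0) {ζ η : ℂ}
    (hζ : 0 ≤ ζ.im) (hη : 0 ≤ η.im) : dist (foldMap p e a b ζ) (foldMap p e a b η) = dist ζ η := by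
  rw [foldMap_of_nonneg hζ, foldMap_of_nonneg hη, dist_eq_norm, dist_eq_norm,
    ← norm_smul_add_smul he ha hea, Complex.sub_re, Complex.sub_im, sub_smul, sub_smul]
  congr 1
  abel

theorem dist_foldMap_of_nonpos (he : ‖e‖ = 1) (hb : ‖b‖ = 1) (heb : inner ℝ e b = 0) {ζ η : ℂ}
    (hζ : ζ.im ≤ 0) (hη : η.im ≤ 0) : dist (foldMap p e a b ζ) (foldMap p e a b η) = dist ζ η := by
  rw [foldMap_of_nonpos hζ, foldMap_of_nonpos hη, dist_eq_norm, dist_eq_norm,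
    ← norm_smul_add_smul he hb heb, Complex.sub_re, Complex.sub_im, sub_smul, sub_smul]
  congr 1
  abel

theorem dist_foldMap_le_of_nonneg_of_nonpos (he : ‖e‖ = 1) (ha : ‖a‖ = 1) (hb : ‖b‖ = 1)
    (hea : inner ℝ e a = 0) (heb : inner ℝ e b = 0) {ζ η : ℂ}
    (hζ : 0 ≤ ζ.im) (hη : η.im ≤ 0) : dist (foldMap p e a b ζ) (foldMap p e a b η) ≤ dist ζ η := by
  rw [foldMap_of_nonneg hζ, foldMap_of_nonpos hη, dist_eq_norm, dist_eq_norm]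
  refine le_of_sq_le_sq ?_ (norm_nonneg _)
  have h1 : p + ζ.re • e + ζ.im • a - (p + η.re • e + η.im • b)
      = (ζ.re - η.re) • e + (ζ.im • a - η.im • b) := by rw [sub_smul]; abel
  have h2 : ‖ζ - η‖ ^ 2 = (ζ.re - η.re) ^ 2 + (ζ.im - η.im) ^ 2 := by
    rw [← Complex.normSq_eq_norm_sq, Complex.normSq_apply, Complex.sub_re, Complex.sub_im]; ring
  have hab : inner ℝ a b ≤ 1 := by simpa [ha, hb] using real_inner_le_norm a b
  rw [h1, h2, norm_add_sq_real, norm_sub_sq_real]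
  simp only [norm_smul, inner_smul_left, inner_smul_right, inner_sub_right, hea, heb, he, ha, hb]
  simp only [Real.norm_eq_abs, mul_one, sq_abs, conj_trivial, mul_zero, sub_zero]
  nlinarith [mul_nonneg hζ (neg_nonneg.2 hη)]

theorem lipschitzWith_foldMap (he : ‖e‖ = 1) (ha : ‖a‖ = 1) (hb : ‖b‖ = 1)
    (hea : inner ℝ e a = 0) (heb : inner ℝ e b = 0) : LipschitzWith 1 (foldMap p e a b) := by
  refine LipschitzWith.of_dist_le_mul fun ζ η => ?_
  rw [NNReal.coe_one, one_mul]
  rcases le_total 0 ζ.im with hζ | hζ <;> rcases le_total 0 η.im with hη | hη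
  · exact (dist_foldMap_of_nonneg he ha hea hζ hη).le
  · exact dist_foldMap_le_of_nonneg_of_nonpos he ha hb hea heb hζ hη
  · rw [dist_comm, dist_comm ζ]
    exact dist_foldMap_le_of_nonneg_of_nonpos he ha hb hea heb hη hζ
  · exact (dist_foldMap_of_nonpos he hb heb hζ hη).le

theorem dist_foldMap_self (he : ‖e‖ = 1) (ha : ‖a‖ = 1) (hb : ‖b‖ = 1)
    (hea : inner ℝ e a = 0) (heb : inner ℝ e b = 0) (ζ : ℂ) :
    dist (foldMap p e a b ζ) p = ‖ζ‖ := by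
  rw [← dist_zero_right]
  rcases le_total 0 ζ.im with h | h
  · have := dist_foldMap_of_nonneg (p := p) (b := b) he ha hea h (η := 0) le_rfl
    rwa [foldMap_zero] at this
  · have := dist_foldMap_of_nonpos (p := p) (a := a) he hb heb h (η := 0) le_rfl
    rwa [foldMap_zero] at this

/-- If the surface `F` is a folded plane near `p`, then the fold map is an isometry for the
intrinsic distance near `p`. -/
theorem pathDist_foldMap_eq_edist (he : ‖e‖ = 1) (ha : ‖a‖ = 1) (hb : ‖b‖ = 1)
    (hea : inner ℝ e a = 0) (heb : inner ℝ e b = 0) {f : V} (hfe : inner ℝ f e = 0)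
    (hfa : 0 < inner ℝ f a) (hfb : 0 < inner ℝ f b) {F : Set V} {r : ℝ}
    (hF : ∀ ζ : ℂ, ‖ζ‖ < 4 * r → foldMap p e a b ζ ∈ F)
    (hsurj : ∀ x ∈ F, dist x p < 4 * r → ∃ ζ, foldMap p e a b ζ = x) {ζ η : ℂ}
    (hζ : ‖ζ‖ < r) (hη : ‖η‖ < r) :
    pathDist F (foldMap p e a b ζ) (foldMap p e a b η) = edist ζ η := by
  have hr : 0 < r := (norm_nonneg _).trans_lt hζ
  have hlip := lipschitzWith_foldMap (p := p) he ha hb hea heb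
  have hself := dist_foldMap_self (p := p) he ha hb hea heb
  apply le_antisymm
  · refine pathDist_le_of_lipschitzOnWith_segment hlip.lipschitzOnWith fun u hu => hF u ?_
    have : u ∈ Metric.ball (0 : ℂ) r := (convex_ball (0 : ℂ) r).segment_subset (by simpa using hζ)
      (by simpa using hη) hu
    rw [mem_ball_zero_iff] at this
    linarith
  have hY : ∀ ξ : ℂ, inner ℝ f (foldMap p e a b ξ) =
      inner ℝ f p + ξ.im * (if 0 ≤ ξ.im then inner ℝ f a else inner ℝ f b) := by
    intro ξ
    rw [foldMap, inner_add_right, inner_add_right, inner_smul_right, inner_smul_right, hfe]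
    split_ifs <;> ring
  have hYpos : ∀ ξ : ℂ, 0 ≤ ξ.im → inner ℝ f p ≤ inner ℝ f (foldMap p e a b ξ) := by
    intro ξ hξ
    rw [hY, if_pos hξ]
    linarith [mul_nonneg hξ hfa.le]
  have hYneg : ∀ ξ : ℂ, ξ.im ≤ 0 → inner ℝ f (foldMap p e a b ξ) ≤ inner ℝ f p := by
    intro ξ hξ
    rw [hY]
    split_ifs <;> nlinarith
  have hYzero : ∀ ξ : ℂ, inner ℝ f (foldMap p e a b ξ) = inner ℝ f p → ξ.im = 0 := by
    intro ξ hξ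
    rw [hY] at hξ
    have h0 : ξ.im * (if 0 ≤ ξ.im then inner ℝ f a else inner ℝ f b) = 0 := by linarith
    rcases mul_eq_zero.1 h0 with h | h
    · exact h
    · split_ifs at h <;> linarith
  rw [le_pathDist_iff]
  intro α β c hc
  have hα := Set.left_mem_Icc.2 hc.le
  have hβ := Set.right_mem_Icc.2 hc.le
  by_cases hfar : ∃ t ∈ Set.Icc α β, 4 * r ≤ dist (c t) p
  · obtain ⟨t, ht, hfar⟩ := hfar
    refine le_trans ?_ (eVariationOn.edist_le c hα ht)
    rw [edist_dist, edist_dist]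
    apply ENNReal.ofReal_le_ofReal
    have h1 := dist_triangle_left (c t) p (c α)
    have h2 := hself ζ
    rw [← hc.source] at h2
    have h3 : dist ζ η ≤ ‖ζ‖ + ‖η‖ := by rw [dist_eq_norm]; exact norm_sub_le _ _
    linarith
  push Not at hfar
  have hend : edist (foldMap p e a b ζ) (foldMap p e a b η) ≤ eVariationOn c (Set.Icc α β) := by
    have := eVariationOn.edist_le c hα hβ
    rwa [hc.source, hc.target] at this
  have hmid : ∀ t ∈ Set.Icc α β, inner ℝ f (c t) = inner ℝ f p → edist ζ η ≤
      eVariationOn c (Set.Icc α β) := by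
    intro t ht hft
    obtain ⟨ξ, hξ⟩ := hsurj (c t) (hc.mem t ht) (hfar t ht)
    have hξ0 : ξ.im = 0 := hYzero ξ (by rw [hξ, hft])
    have hd : ∀ ζ : ℂ, edist (foldMap p e a b ζ) (c t) = edist ζ ξ := by
      intro ζ
      rw [← hξ, edist_dist, edist_dist]
      rcases le_total 0 ζ.im with h | h
      · rw [dist_foldMap_of_nonneg he ha hea h hξ0.ge]
      · rw [dist_foldMap_of_nonpos he hb heb h hξ0.le]
    have hadd := eVariationOn.Icc_add_Icc c (s := Set.univ) ht.1 ht.2 (Set.mem_univ t)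
    simp only [Set.univ_inter] at hadd
    rw [← hadd]
    refine (edist_triangle ζ ξ η).trans (add_le_add ?_ ?_)
    · have := eVariationOn.edist_le c (Set.left_mem_Icc.2 ht.1) (Set.right_mem_Icc.2 ht.1)
      rwa [hc.source, hd] at this
    · have := eVariationOn.edist_le c (Set.right_mem_Icc.2 ht.2) (Set.left_mem_Icc.2 ht.2)
      rwa [hc.target, hd, edist_comm] at this
  have hcont : ContinuousOn (fun t => inner ℝ f (c t)) (Set.Icc α β) :=
    continuousOn_const.inner hc.cont
  rcases le_total 0 ζ.im with h1 | h1 <;> rcases le_total 0 η.im with h2 | h2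
  · rwa [edist_dist, dist_foldMap_of_nonneg he ha hea h1 h2, ← edist_dist] at hend
  · obtain ⟨t, ht, hft⟩ := intermediate_value_Icc' hc.le hcont
      (show inner ℝ f p ∈ Set.Icc (inner ℝ f (c β)) (inner ℝ f (c α)) from
        ⟨by rw [hc.target]; exact hYneg _ h2, by rw [hc.source]; exact hYpos _ h1⟩)
    exact hmid t ht hft
  · obtain ⟨t, ht, hft⟩ := intermediate_value_Icc hc.le hcont
      (show inner ℝ f p ∈ Set.Icc (inner ℝ f (c α)) (inner ℝ f (c β)) from
        ⟨by rw [hc.source]; exact hYneg _ h1, by rw [hc.target]; exact hYpos _ h2⟩)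
    exact hmid t ht hft
  · rwa [edist_dist, dist_foldMap_of_nonpos he hb heb h1 h2, ← edist_dist] at hend

end Fold

section Orientation

/-- The determinant of three vectors in Euclidean space. -/
def tripleProduct (x y z : EuclideanSpace ℝ (Fin 3)) : ℝ :=
  x 0 * (y 1 * z 2 - y 2 * z 1) - x 1 * (y 0 * z 2 - y 2 * z 0) + x 2 * (y 0 * z 1 - y 1 * z 0)

theorem tripleProduct_sq_of_orthonormal {x y z : EuclideanSpace ℝ (Fin 3)} (hx : ‖x‖ = 1)
    (hy : ‖y‖ = 1) (hz : ‖z‖ = 1) (hxy : inner ℝ x y = 0) (hxz : inner ℝ x z = 0)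
    (hyz : inner ℝ y z = 0) : tripleProduct x y z ^ 2 = 1 := by
  have key : tripleProduct x y z ^ 2 =
      inner ℝ x x * (inner ℝ y y * inner ℝ z z - inner ℝ y z ^ 2)
      - inner ℝ x y * (inner ℝ x y * inner ℝ z z - inner ℝ y z * inner ℝ x z)
      + inner ℝ x z * (inner ℝ x y * inner ℝ y z - inner ℝ y y * inner ℝ x z) := by
    simp only [tripleProduct, PiLp.inner_apply, Fin.sum_univ_three, RCLike.inner_apply,
      conj_trivial]
    ring
  rw [key, hxy, hxz, hyz]
  simp only [real_inner_self_eq_norm_sq, hx, hy, hz]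
  norm_num

/-- `G` is affine near `ζ`, with image plane oriented with respect to the point `o`. -/
def IsOrientedAt (o : EuclideanSpace ℝ (Fin 3)) (G : ℂ → EuclideanSpace ℝ (Fin 3)) (ζ : ℂ) :
    Prop :=
  ∃ u v : EuclideanSpace ℝ (Fin 3),
    (∀ᶠ η in nhds ζ, G η = G ζ + (η - ζ).re • u + (η - ζ).im • v) ∧
    tripleProduct u v (o - G ζ) < 0

end Orientation

local notation "E3" => EuclideanSpace ℝ (Fin 3)

section Frame

theorem exists_orthonormal_frame {e d : E3} (he : ‖e‖ = 1) (hd : ∀ t : ℝ, d ≠ t • e) :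
    ∃ f w : E3, ∃ τ κ : ℝ, ‖f‖ = 1 ∧ ‖w‖ = 1 ∧ inner ℝ e f = 0 ∧ inner ℝ e w = 0 ∧
      inner ℝ f w = 0 ∧ 0 < κ ∧ d = τ • e + κ • w ∧ tripleProduct e f w < 0 ∧
      ∀ x : E3, x = (inner ℝ e x : ℝ) • e + (inner ℝ f x : ℝ) • f + (inner ℝ w x : ℝ) • w := by
  have hee : inner ℝ e e = (1 : ℝ) := by rw [real_inner_self_eq_norm_sq, he]; norm_num
  set τ : ℝ := inner ℝ e d with hτ
  have hd0 : d - τ • e ≠ 0 := sub_ne_zero.2 (hd τ)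
  have hκ : 0 < ‖d - τ • e‖ := norm_pos_iff.2 hd0
  set κ := ‖d - τ • e‖ with hκdef
  obtain ⟨w, hw⟩ : ∃ w, w = κ⁻¹ • (d - τ • e) := ⟨_, rfl⟩
  have hw1 : ‖w‖ = 1 := by
    rw [hw, norm_smul, norm_inv, ← hκdef, Real.norm_of_nonneg hκ.le, inv_mul_cancel₀ hκ.ne']
  have hew : inner ℝ e w = 0 := by
    rw [hw, inner_smul_right, inner_sub_right, inner_smul_right, hee, ← hτ]; ring
  have hdw : d = τ • e + κ • w := by rw [hw, smul_inv_smul₀ hκ.ne']; abel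
  obtain ⟨g, hg0, heg, hwg⟩ := exists_ne_zero_inner_eq_zero (V := E3) (by simp) e w
  have hg : 0 < ‖g‖ := norm_pos_iff.2 hg0
  obtain ⟨f, hf1, hef, hwf, hdet⟩ : ∃ f : E3, ‖f‖ = 1 ∧ inner ℝ e f = 0 ∧ inner ℝ w f = 0 ∧
      tripleProduct e f w < 0 := by
    have hf1 : ‖‖g‖⁻¹ • g‖ = 1 := by
      rw [norm_smul, norm_inv, norm_norm, inv_mul_cancel₀ hg.ne']
    have hef : inner ℝ e (‖g‖⁻¹ • g) = 0 := by rw [inner_smul_right, heg, mul_zero]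
    have hwf : inner ℝ w (‖g‖⁻¹ • g) = 0 := by rw [inner_smul_right, hwg, mul_zero]
    have hsq := tripleProduct_sq_of_orthonormal he hf1 hw1 hef hew (by rwa [real_inner_comm])
    rw [sq] at hsq
    rcases mul_self_eq_one_iff.1 hsq with h | h
    · refine ⟨-(‖g‖⁻¹ • g), by rwa [norm_neg], by rw [inner_neg_right, hef, neg_zero],
        by rw [inner_neg_right, hwf, neg_zero], ?_⟩
      have : tripleProduct e (-(‖g‖⁻¹ • g)) w = - tripleProduct e (‖g‖⁻¹ • g) w := by
        simp only [tripleProduct, PiLp.neg_apply]; ring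
      rw [this, h]; norm_num
    · exact ⟨_, hf1, hef, hwf, by rw [h]; norm_num⟩
  have hfw : inner ℝ f w = 0 := by rwa [real_inner_comm]
  refine ⟨f, w, τ, κ, hf1, hw1, hef, hew, hfw, hκ, hdw, hdet, fun x => ?_⟩
  have hfe : inner ℝ f e = 0 := by rwa [real_inner_comm]
  have hwe : inner ℝ w e = 0 := by rwa [real_inner_comm]
  have hon : Orthonormal ℝ ![e, f, w] := by
    refine ⟨fun i => ?_, fun i j hij => ?_⟩
    · fin_cases i <;> simpa
    · fin_cases i <;> fin_cases j <;> first | exact absurd rfl hij | simpa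
  have hspan : ⊤ ≤ Submodule.span ℝ (Set.range ![e, f, w]) :=
    (hon.linearIndependent.span_eq_top_of_card_eq_finrank (by simp)).ge
  have := (OrthonormalBasis.mk hon hspan).sum_repr' x
  simpa [Fin.sum_univ_three] using this.symm

/-- Away from its vertices, the boundary of a polytope is locally a folded plane. -/
theorem exists_foldMap_frontier {K : Set E3} {T : Finset (E3 × ℝ)} (hT0 : ∀ i ∈ T, i.1 ≠ 0)
    (hT : ∀ x, x ∈ K ↔ ∀ i ∈ T, inner ℝ i.1 x ≤ i.2) {o p e : E3} (ho : o ∈ interior K)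
    (hp : p ∈ frontier K) (he : ‖e‖ = 1)
    (hact : ∀ i ∈ T, inner ℝ i.1 p = i.2 → inner ℝ i.1 e = 0) :
    ∃ a b f : E3, ∃ r > 0, ‖a‖ = 1 ∧ ‖b‖ = 1 ∧ inner ℝ e a = 0 ∧ inner ℝ e b = 0 ∧
      inner ℝ f e = 0 ∧ 0 < inner ℝ f a ∧ 0 < inner ℝ f b ∧
      (∀ ζ : ℂ, ‖ζ‖ < 4 * r → foldMap p e a b ζ ∈ frontier K) ∧
      (∀ x ∈ frontier K, dist x p < 4 * r → ∃ ζ, foldMap p e a b ζ = x) ∧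
      tripleProduct e a (o - p) < 0 ∧ tripleProduct e b (o - p) < 0 := by
  classical
  have hfr := mem_frontier_iff_of_halfspaces hT0 hT
  have hoT := (mem_interior_iff_of_halfspaces hT0 hT o).1 ho
  obtain ⟨hpT, i₀, hi₀, hpi₀⟩ := (hfr p).1 hp
  obtain ⟨f, w, τ, κ, hf1, hw1, hef, hew, hfw, hκ, hd, hdet, hexp⟩ :=
    exists_orthonormal_frame (d := o - p) he (by
      intro t ht
      have h1 := hoT i₀ hi₀
      have h2 : inner ℝ i₀.1 (o - p) = 0 := by
        rw [ht, inner_smul_right, hact i₀ hi₀ hpi₀, mul_zero]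
      rw [inner_sub_right, hpi₀] at h2
      linarith)
  have hee : inner ℝ e e = (1 : ℝ) := by rw [real_inner_self_eq_norm_sq, he]; norm_num
  have hff : inner ℝ f f = (1 : ℝ) := by rw [real_inner_self_eq_norm_sq, hf1]; norm_num
  have hww : inner ℝ w w = (1 : ℝ) := by rw [real_inner_self_eq_norm_sq, hw1]; norm_num
  have hfe : inner ℝ f e = 0 := by rwa [real_inner_comm]
  have hwe : inner ℝ w e = 0 := by rwa [real_inner_comm]
  have hwf : inner ℝ w f = 0 := by rwa [real_inner_comm]
  have hw : ∀ i ∈ T, inner ℝ i.1 p = i.2 → inner ℝ i.1 w < 0 := by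
    intro i hi hip
    have h1 := hoT i hi
    have h2 : inner ℝ i.1 (o - p) = κ * inner ℝ i.1 w := by
      rw [hd, inner_add_right, inner_smul_right, inner_smul_right, hact i hi hip, mul_zero,
        zero_add]
    rw [inner_sub_right, hip] at h2
    nlinarith
  set A := T.filter fun i => inner ℝ i.1 p = i.2 with hA
  set m : E3 × ℝ → ℝ := fun i => inner ℝ i.1 f / (- inner ℝ i.1 w) with hm
  have hAne : A.Nonempty := ⟨i₀, by simp [hA, hi₀, hpi₀]⟩
  obtain ⟨jM, hjM, hM⟩ := A.exists_max_image m hAne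
  obtain ⟨jm, hjm, hmin⟩ := A.exists_min_image m hAne
  obtain ⟨r₀, hr₀, hinact⟩ := exists_radius_of_active (T := T) p
  -- membership in terms of the frame coordinates
  have hval : ∀ i ∈ A, ∀ x : E3, inner ℝ i.1 x - i.2 =
      (- inner ℝ i.1 w) * (inner ℝ f (x - p) * m i - inner ℝ w (x - p)) := by
    intro i hi x
    obtain ⟨hiT, hip⟩ := Finset.mem_filter.1 hi
    have hwi := hw i hiT hip
    have h1 : inner ℝ i.1 x - i.2 = inner ℝ i.1 (x - p) := by rw [inner_sub_right, hip]
    rw [h1]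
    conv_lhs => rw [hexp (x - p)]
    rw [inner_add_right, inner_add_right, inner_smul_right, inner_smul_right, inner_smul_right,
      hact i hiT hip]
    simp only [hm]
    rw [mul_sub, mul_left_comm, mul_div_cancel₀ _ (by linarith)]
    ring
  set h : ℝ → ℝ := fun y => if 0 ≤ y then y * m jM else y * m jm with hh
  have hmax : ∀ y, ∀ i ∈ A, y * m i ≤ h y := by
    intro y i hi
    simp only [hh]
    split_ifs with hy
    · exact mul_le_mul_of_nonneg_left (hM i hi) hy
    · exact mul_le_mul_of_nonpos_left (hmin i hi) (le_of_not_ge hy)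
  have hatt : ∀ y, ∃ i ∈ A, y * m i = h y := by
    intro y
    simp only [hh]
    split_ifs with hy
    · exact ⟨jM, hjM, rfl⟩
    · exact ⟨jm, hjm, rfl⟩
  have hloc : ∀ x, dist x p < r₀ → (x ∈ frontier K ↔ inner ℝ w (x - p) = h (inner ℝ f (x - p))) := by
    intro x hx
    rw [hfr]
    constructor
    · rintro ⟨hle, i, hi, hxi⟩
      have hiA : i ∈ A := by
        refine Finset.mem_filter.2 ⟨hi, le_antisymm (hpT i hi) (not_lt.1 fun hlt => ?_)⟩
        exact (hinact x hx i hi hlt).ne hxi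
      have hv := hval i hiA x
      have hwi := hw i hi (Finset.mem_filter.1 hiA).2
      have h1 : inner ℝ w (x - p) = inner ℝ f (x - p) * m i := by
        rw [hxi, sub_self, eq_comm, mul_eq_zero] at hv
        rcases hv with hv | hv <;> linarith
      apply le_antisymm
      · rw [h1]; exact hmax _ i hiA
      · obtain ⟨j, hj, hjy⟩ := hatt (inner ℝ f (x - p))
        have hv := hval j hj x
        obtain ⟨hjT, hjp⟩ := Finset.mem_filter.1 hj
        have hwj := hw j hjT hjp
        have := hle j hjT
        rw [← hjy]
        by_contra! hlt
        nlinarith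
    · intro hx'
      refine ⟨fun i hi => ?_, ?_⟩
      · rcases (hpT i hi).eq_or_lt with hip | hip
        · have hiA : i ∈ A := Finset.mem_filter.2 ⟨hi, hip⟩
          have hv := hval i hiA x
          have hwi := hw i hi hip
          have := hmax (inner ℝ f (x - p)) i hiA
          nlinarith
        · exact (hinact x hx i hi hip).le
      · obtain ⟨j, hj, hjy⟩ := hatt (inner ℝ f (x - p))
        refine ⟨j, (Finset.mem_filter.1 hj).1, ?_⟩
        have hv := hval j hj x
        rw [hjy, hx', sub_self, mul_zero] at hv
        linarith
  -- the two half-plane directions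
  have hdir : ∀ s : ℝ, ∃ a : E3, ∃ k > 0, ‖a‖ = 1 ∧ inner ℝ e a = 0 ∧ inner ℝ f a = k ∧
      inner ℝ w a = k * s ∧ tripleProduct e a (o - p) < 0 := by
    intro s
    set k := (√(1 + s ^ 2))⁻¹ with hk
    have hkpos : 0 < k := by positivity
    have hk2 : k ^ 2 * (1 + s ^ 2) = 1 := by
      rw [hk, inv_pow, Real.sq_sqrt (by positivity), inv_mul_cancel₀ (by positivity)]
    refine ⟨k • f + (k * s) • w, k, hkpos, ?_, ?_, ?_, ?_, ?_⟩
    · have h1 := norm_smul_add_smul_sq hf1 hw1 hfw k (k * s)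
      have h2 : ‖k • f + (k * s) • w‖ ^ 2 = 1 := by rw [h1, ← hk2]; ring
      exact (pow_eq_one_iff_of_nonneg (norm_nonneg _) two_ne_zero).1 h2
    · rw [inner_add_right, inner_smul_right, inner_smul_right, hef, hew]; ring
    · rw [inner_add_right, inner_smul_right, inner_smul_right, hff, hfw]; ring
    · rw [inner_add_right, inner_smul_right, inner_smul_right, hwf, hww]; ring
    · have : tripleProduct e (k • f + (k * s) • w) (o - p) = (k * κ) * tripleProduct e f w := by
        rw [hd]
        simp only [tripleProduct, PiLp.add_apply, PiLp.smul_apply, smul_eq_mul]; ring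
      rw [this]
      exact mul_neg_of_pos_of_neg (by positivity) hdet
  obtain ⟨a, ka, hka, ha1, hea, hfa, hwa, hdeta⟩ := hdir (m jM)
  obtain ⟨b, kb, hkb, hb1, heb, hfb, hwb, hdetb⟩ := hdir (m jm)
  have hself := dist_foldMap_self (p := p) he ha1 hb1 hea heb
  have hcoord : ∀ ζ : ℂ, inner ℝ e (foldMap p e a b ζ - p) = ζ.re ∧
      (0 ≤ ζ.im → inner ℝ f (foldMap p e a b ζ - p) = ζ.im * ka ∧
        inner ℝ w (foldMap p e a b ζ - p) = ζ.im * ka * m jM) ∧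
      (ζ.im ≤ 0 → inner ℝ f (foldMap p e a b ζ - p) = ζ.im * kb ∧
        inner ℝ w (foldMap p e a b ζ - p) = ζ.im * kb * m jm) := by
    intro ζ
    refine ⟨?_, fun hζ => ?_, fun hζ => ?_⟩
    · rw [foldMap, add_assoc, add_sub_cancel_left, inner_add_right, inner_smul_right,
        inner_smul_right, hee]
      split_ifs <;> simp [hea, heb]
    · rw [foldMap_of_nonneg hζ, add_assoc, add_sub_cancel_left, inner_add_right, inner_smul_right,
        inner_smul_right, inner_add_right, inner_smul_right, inner_smul_right, hfe, hfa, hwe, hwa]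
      constructor <;> ring
    · rw [foldMap_of_nonpos hζ, add_assoc, add_sub_cancel_left, inner_add_right, inner_smul_right,
        inner_smul_right, inner_add_right, inner_smul_right, inner_smul_right, hfe, hfb, hwe, hwb]
      constructor <;> ring
  have hext : ∀ {x y : E3}, inner ℝ e x = inner ℝ e y → (inner ℝ f x : ℝ) = inner ℝ f y →
      (inner ℝ w x : ℝ) = inner ℝ w y → x = y := by
    intro x y h1 h2 h3
    rw [hexp x, hexp y, h1, h2, h3]
  refine ⟨a, b, f, r₀ / 4, by positivity, ha1, hb1, hea, heb, hfe, by rwa [hfa], by rwa [hfb],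
    ?_, ?_, hdeta, hdetb⟩
  · intro ζ hζ
    rw [hloc _ (by rw [hself]; linarith)]
    obtain ⟨-, h1, h2⟩ := hcoord ζ
    simp only [hh]
    rcases le_or_gt 0 ζ.im with hζ' | hζ'
    · obtain ⟨h1, h2⟩ := h1 hζ'
      rw [h1, h2, if_pos (by positivity)]
    · obtain ⟨h1, h2⟩ := h2 hζ'.le
      rw [h1, h2, if_neg (not_le.2 (mul_neg_of_neg_of_pos hζ' hkb))]
  · intro x hx hxp
    rw [hloc x (by linarith)] at hx
    simp only [hh] at hx
    rcases le_or_gt 0 (inner ℝ f (x - p)) with hY | hY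
    · rw [if_pos hY] at hx
      obtain ⟨h0, h1, -⟩ := hcoord ⟨inner ℝ e (x - p), inner ℝ f (x - p) / ka⟩
      obtain ⟨h1, h2⟩ := h1 (div_nonneg hY hka.le)
      refine ⟨⟨inner ℝ e (x - p), inner ℝ f (x - p) / ka⟩,
        sub_left_injective (b := p) (hext h0 ?_ ?_)⟩
      · rw [h1, div_mul_cancel₀ _ hka.ne']
      · rw [h2, div_mul_cancel₀ _ hka.ne', hx]
    · rw [if_neg (not_le.2 hY)] at hx
      obtain ⟨h0, -, h1⟩ := hcoord ⟨inner ℝ e (x - p), inner ℝ f (x - p) / kb⟩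
      obtain ⟨h1, h2⟩ := h1 (div_nonpos_of_nonpos_of_nonneg hY.le hkb.le)
      refine ⟨⟨inner ℝ e (x - p), inner ℝ f (x - p) / kb⟩,
        sub_left_injective (b := p) (hext h0 ?_ ?_)⟩
      · rw [h1, div_mul_cancel₀ _ hkb.ne']
      · rw [h2, div_mul_cancel₀ _ hkb.ne', hx]

end Frame

section ArcLength

variable {α : Type*} [PseudoEMetricSpace α] {γ : ℝ → α}

theorem Function.Periodic.eVariationOn_Icc_add (h : Function.Periodic γ 1) (a b : ℝ) (k : ℤ) :
    eVariationOn γ (Set.Icc (a + k) (b + k)) = eVariationOn γ (Set.Icc a b) := by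
  have h1 := eVariationOn.comp_eq_of_monotoneOn γ (t := Set.Icc a b) (fun t => t + (k : ℝ))
    (fun x _ y _ hxy => by simpa using hxy)
  rw [Set.image_add_const_Icc] at h1
  rw [← h1]
  congr 1
  funext t
  have := h.int_mul k t
  rwa [mul_one] at this

theorem eVariationOn.Icc_add_Icc_univ (γ : ℝ → α) {a b c : ℝ} (hab : a ≤ b) (hbc : b ≤ c) :
    eVariationOn γ (Set.Icc a b) + eVariationOn γ (Set.Icc b c) = eVariationOn γ (Set.Icc a c) := by
  have := eVariationOn.Icc_add_Icc γ (s := Set.univ) hab hbc (Set.mem_univ b)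
  simpa only [Set.univ_inter] using this

theorem Function.Periodic.eVariationOn_Icc_lt_top (h : Function.Periodic γ 1)
    (hfin : eVariationOn γ (Set.Icc 0 1) < ⊤) (a b : ℝ) : eVariationOn γ (Set.Icc a b) < ⊤ := by
  have h1 : ∀ k : ℤ, eVariationOn γ (Set.Icc (k : ℝ) (k + 1)) < ⊤ := by
    intro k
    have := h.eVariationOn_Icc_add 0 1 k
    rw [zero_add, add_comm] at this
    rwa [this]
  have h2 : ∀ n : ℕ, eVariationOn γ (Set.Icc (-(n : ℝ)) n) < ⊤ := by
    intro n
    induction n with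
    | zero => simp [eVariationOn.subsingleton]
    | succ n ih =>
      have hn : (0 : ℝ) ≤ n := n.cast_nonneg
      push_cast
      rw [← eVariationOn.Icc_add_Icc_univ γ (b := (n : ℝ)) (by linarith) (by linarith),
        ← eVariationOn.Icc_add_Icc_univ γ (b := -(n : ℝ)) (by linarith) (by linarith)]
      refine ENNReal.add_lt_top.2 ⟨ENNReal.add_lt_top.2 ⟨?_, ih⟩, by simpa using h1 n⟩
      have := h1 (-(n + 1 : ℤ))
      push_cast at this
      simpa using this
  obtain ⟨n, hn⟩ := exists_nat_ge (max |a| |b|)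
  refine lt_of_le_of_lt (eVariationOn.mono γ ?_) (h2 n)
  have ha := (le_max_left _ _).trans hn
  have hb := (le_max_right _ _).trans hn
  exact Set.Icc_subset_Icc (abs_le.1 ha).1 (abs_le.1 hb).2

/-- The arc-length function of a periodic rectifiable curve. -/
theorem Function.Periodic.exists_arclength (h : Function.Periodic γ 1)
    (hfin : eVariationOn γ (Set.Icc 0 1) < ⊤) : ∃ s : ℝ → ℝ, Monotone s ∧
      (∀ a b, a ≤ b → eVariationOn γ (Set.Icc a b) = ENNReal.ofReal (s b - s a)) ∧
      ∀ t, s (t + 1) = s t + (eVariationOn γ (Set.Icc 0 1)).toReal := by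
  have hloc : LocallyBoundedVariationOn γ Set.univ := by
    intro a b _ _
    rw [Set.univ_inter]
    exact (h.eVariationOn_Icc_lt_top hfin a b).ne
  have hdiff : ∀ a b, a ≤ b → variationOnFromTo γ Set.univ 0 b - variationOnFromTo γ Set.univ 0 a
      = (eVariationOn γ (Set.Icc a b)).toReal := by
    intro a b hab
    rw [variationOnFromTo.sub_right hloc (Set.mem_univ _) (Set.mem_univ _) (Set.mem_univ _),
      variationOnFromTo.eq_of_le _ _ hab, Set.univ_inter]
  refine ⟨variationOnFromTo γ Set.univ 0, ?_, fun a b hab => ?_, fun t => ?_⟩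
  · exact monotoneOn_univ.1 (variationOnFromTo.monotoneOn hloc (Set.mem_univ _))
  · rw [hdiff a b hab, ENNReal.ofReal_toReal (h.eVariationOn_Icc_lt_top hfin a b).ne]
  · rw [← sub_eq_iff_eq_add', hdiff _ _ (by linarith)]
    congr 1
    have e1 := h.eVariationOn_Icc_add (Int.fract t) (Int.fract t + 1) ⌊t⌋
    have e2 : Int.fract t + 1 + ⌊t⌋ = t + 1 := by rw [add_right_comm, Int.fract_add_floor]
    rw [Int.fract_add_floor, e2] at e1
    have hf0 := Int.fract_nonneg t
    have hf1 := (Int.fract_lt_one t).le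
    have e3 := h.eVariationOn_Icc_add 0 (Int.fract t) 1
    rw [Int.cast_one, zero_add] at e3
    rw [e1, ← eVariationOn.Icc_add_Icc_univ γ hf1 (by linarith), e3, add_comm,
      eVariationOn.Icc_add_Icc_univ γ hf0 hf1]

end ArcLength

section Straight

variable {V : Type*} [NormedAddCommGroup V] [NormedSpace ℝ V] [StrictConvexSpace ℝ V]

/-- An isometric curve in a strictly convex space is straight. -/
theorem exists_unit_smul_of_isometric {f : ℝ → V} {c : ℝ} (hc : 0 < c) (hf0 : f 0 = 0)
    (hf : ∀ s ∈ Set.Icc (-c) c, ∀ t ∈ Set.Icc (-c) c, dist (f s) (f t) = |s - t|) :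
    ∃ u : V, ‖u‖ = 1 ∧ ∀ t ∈ Set.Icc (-c) c, f t = t • u := by
  have hl : -c ∈ Set.Icc (-c) c := ⟨le_rfl, by linarith⟩
  have hr : c ∈ Set.Icc (-c) c := ⟨by linarith, le_rfl⟩
  have h0 : (0 : ℝ) ∈ Set.Icc (-c) c := ⟨by linarith, hc.le⟩
  have hD : dist (f (-c)) (f c) = 2 * c := by
    rw [hf _ hl _ hr, show -c - c = -(2 * c) by ring, abs_neg, abs_of_pos (by linarith)]
  have hline : ∀ t ∈ Set.Icc (-c) c,
      f t = f (-c) + ((t + c) / (2 * c)) • (f c - f (-c)) := by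
    intro t ht
    have := eq_lineMap_of_dist_eq_mul_of_dist_eq_mul (x := f (-c)) (y := f t) (z := f c)
      (r := (t + c) / (2 * c)) (by
        rw [hf _ hl _ ht, hD, abs_sub_comm, abs_of_nonneg (by linarith [ht.1])]
        field_simp
        ring) (by
        rw [hf _ ht _ hr, hD, abs_sub_comm, abs_of_nonneg (by linarith [ht.2])]
        field_simp
        ring)
    rw [this, AffineMap.lineMap_apply_module']
    abel
  have hmid : f (-c) = -((1 / 2 : ℝ) • (f c - f (-c))) := by
    have := hline 0 h0
    rw [hf0, zero_add, show c / (2 * c) = 1 / 2 by field_simp] at this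
    exact eq_neg_of_add_eq_zero_left this.symm
  refine ⟨(1 / (2 * c)) • (f c - f (-c)), ?_, fun t ht => ?_⟩
  · rw [norm_smul, ← dist_eq_norm, dist_comm, hD, Real.norm_of_nonneg (by positivity)]
    field_simp
  · rw [hline t ht]
    nth_rewrite 1 [hmid]
    rw [smul_smul, ← neg_smul, ← add_smul]
    congr 1
    field_simp
    ring

end Straight

section Chart

/-- An isometric chart `G` of the surface `F` on a plane domain `W`, developing the curve `β`
onto the real axis and affine and oriented with respect to `o` on a dense open set. It covers
the discs of radius `ρ` about `σ₀` and about `β σ₀`. -/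
structure IsChartAt (F : Set E3) (o : E3) (β : ℝ → E3) (G : ℂ → E3) (W : Set ℂ) (σ₀ ρ : ℝ) :
    Prop where
  pos : 0 < ρ
  isom : ∀ ζ ∈ W, ∀ η ∈ W, pathDist F (G ζ) (G η) = edist ζ η
  mem : ∀ ζ ∈ W, G ζ ∈ F
  real : ∀ σ : ℝ, (σ : ℂ) ∈ W → G σ = β σ
  oriented : ∃ D : Set ℂ, IsOpen D ∧ Dense D ∧ ∀ ζ ∈ D, IsOrientedAt o G ζ
  ball_subset : Metric.ball (σ₀ : ℂ) ρ ⊆ W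
  surj : ∀ x ∈ F, dist x (β σ₀) < ρ → ∃ ζ ∈ W, G ζ = x

theorem isOrientedAt_foldMap {o p e a b : E3} (ha : tripleProduct e a (o - p) < 0)
    (hb : tripleProduct e b (o - p) < 0) {ζ : ℂ} (hζ : ζ.im ≠ 0) :
    IsOrientedAt o (foldMap p e a b) ζ := by
  have key : ∀ c : E3, tripleProduct e c (o - (p + ζ.re • e + ζ.im • c))
      = tripleProduct e c (o - p) := by
    intro c
    simp only [tripleProduct, PiLp.add_apply, PiLp.smul_apply, PiLp.sub_apply, smul_eq_mul]
    ring
  rcases hζ.lt_or_gt with h | h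
  · refine ⟨e, b, ?_, by rwa [foldMap_of_nonpos h.le, key]⟩
    filter_upwards [(isOpen_lt Complex.continuous_im continuous_const).mem_nhds h] with η hη
    rw [foldMap_of_nonpos h.le, foldMap_of_nonpos (le_of_lt hη), Complex.sub_re, Complex.sub_im]
    module
  · refine ⟨e, a, ?_, by rwa [foldMap_of_nonneg h.le, key]⟩
    filter_upwards [(isOpen_lt continuous_const Complex.continuous_im).mem_nhds h] with η hη
    rw [foldMap_of_nonneg h.le, foldMap_of_nonneg (le_of_lt hη), Complex.sub_re, Complex.sub_im]
    module

theorem IsOrientedAt.comp_mul_sub {o : E3} {φ : ℂ → E3} {u s ζ : ℂ} (hu : u ≠ 0)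
    (h : IsOrientedAt o φ (u * (ζ - s))) : IsOrientedAt o (fun ζ => φ (u * (ζ - s))) ζ := by
  obtain ⟨v, w, hev, hdet⟩ := h
  refine ⟨u.re • v + u.im • w, (-u.im) • v + u.re • w, ?_, ?_⟩
  · have hc : ContinuousAt (fun ζ : ℂ => u * (ζ - s)) ζ := by fun_prop
    filter_upwards [hc.eventually hev] with η hη
    rw [hη, show u * (η - s) - u * (ζ - s) = u * (η - ζ) by ring, Complex.mul_re, Complex.mul_im]
    module
  · have hpos : 0 < u.re ^ 2 + u.im ^ 2 := by
      have := Complex.normSq_pos.2 hu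
      rw [Complex.normSq_apply] at this
      nlinarith
    have : ∀ z : E3, tripleProduct (u.re • v + u.im • w) ((-u.im) • v + u.re • w) z
        = (u.re ^ 2 + u.im ^ 2) * tripleProduct v w z := by
      intro z
      simp only [tripleProduct, PiLp.add_apply, PiLp.smul_apply, smul_eq_mul]
      ring
    rw [this]
    exact mul_neg_of_pos_of_neg hpos hdet

theorem isOpen_dense_im_ne_zero {u : ℂ} (hu : u ≠ 0) (s : ℂ) :
    IsOpen {ζ : ℂ | (u * (ζ - s)).im ≠ 0} ∧ Dense {ζ : ℂ | (u * (ζ - s)).im ≠ 0} := by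
  have hop : IsOpenMap fun ζ : ℂ => (u * (ζ - s)).im :=
    Complex.isOpenMap_im.comp ((Homeomorph.mulLeft₀ u hu).isOpenMap.comp
      (Homeomorph.subRight s).isOpenMap)
  refine ⟨isOpen_ne_fun (by fun_prop) (by fun_prop), ?_⟩
  exact (dense_compl_singleton (0 : ℝ)).preimage hop

variable {K : Set E3} {T : Finset (E3 × ℝ)}

theorem IsSimpleClosedGeodesicIn.injective_mod {F : Set E3} {γ : ℝ → E3}
    (hγ : IsSimpleClosedGeodesicIn F γ) {s t : ℝ} (h : γ s = γ t) : ∃ k : ℤ, s - t = k := by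
  obtain ⟨-, hper, hinj, -⟩ := hγ
  rw [← Int.fract_eq_fract]
  have hfr : ∀ t, γ (Int.fract t) = γ t := by
    intro t
    have := hper.sub_int_mul_eq (x := t) ⌊t⌋
    rwa [mul_one] at this
  refine hinj ⟨Int.fract_nonneg _, Int.fract_lt_one _⟩ ⟨Int.fract_nonneg _, Int.fract_lt_one _⟩ ?_
  rw [hfr, hfr, h]

theorem IsSimpleClosedGeodesicIn.exists_eVariationOn_eq_pathDist {F : Set E3} {γ : ℝ → E3}
    (hγ : IsSimpleClosedGeodesicIn F γ) (t : ℝ) :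
    ∃ ε > 0, ∀ s₁ ∈ Set.Ioo (t - ε) (t + ε), ∀ s₂ ∈ Set.Ioo (t - ε) (t + ε), s₁ ≤ s₂ →
      eVariationOn γ (Set.Icc s₁ s₂) = pathDist F (γ s₁) (γ s₂) := by
  obtain ⟨hcont, -, -, hmem, -, -, hgeo⟩ := hγ
  obtain ⟨ε, hε, h⟩ := hgeo t
  refine ⟨ε, hε, fun s₁ h₁ s₂ h₂ h₁₂ => le_antisymm ?_ ?_⟩
  · rw [le_pathDist_iff]
    exact fun a b c hc => h s₁ s₂ h₁ h₂ h₁₂ a b c hc.le hc.cont hc.source hc.target hc.mem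
  · exact pathDist_le ⟨h₁₂, hcont.continuousOn, rfl, rfl, fun t _ => hmem t⟩

/-- A closed geodesic does not pass through a vertex. -/
theorem IsSimpleClosedGeodesicIn.exists_edge_direction (hT0 : ∀ i ∈ T, i.1 ≠ 0)
    (hT : ∀ x, x ∈ K ↔ ∀ i ∈ T, inner ℝ i.1 x ≤ i.2) {γ : ℝ → E3}
    (hγ : IsSimpleClosedGeodesicIn (frontier K) γ) (t : ℝ) :
    ∃ e : E3, ‖e‖ = 1 ∧ ∀ i ∈ T, inner ℝ i.1 (γ t) = i.2 → inner ℝ i.1 e = 0 := by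
  by_contra! hcon
  have hvert : ∀ e, (∀ i ∈ T, inner ℝ i.1 (γ t) = i.2 → inner ℝ i.1 e = 0) → e = 0 := by
    intro e he
    by_contra he0
    obtain ⟨i, hi, hit, hne⟩ := hcon (‖e‖⁻¹ • e) (by
      rw [norm_smul, norm_inv, norm_norm, inv_mul_cancel₀ (norm_ne_zero_iff.2 he0)])
    rw [inner_smul_right, he i hi hit, mul_zero] at hne
    exact hne rfl
  obtain ⟨r, hr, hshort⟩ := exists_radius_pathDist_lt_of_vertex (by simp) hT0 hT
    (hγ.2.2.2.1 t) hvert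
  obtain ⟨ε, hε, hgeo⟩ := hγ.exists_eVariationOn_eq_pathDist t
  obtain ⟨δ, hδ, hclose⟩ := Metric.continuous_iff.1 hγ.1 t r hr
  obtain ⟨d, hd0, hd⟩ := exists_between (show 0 < min (min ε δ) 1 by positivity)
  rw [lt_min_iff, lt_min_iff] at hd
  obtain ⟨⟨hdε, hdδ⟩, hd1⟩ := hd
  have hne : ∀ s, s ≠ t → |s - t| < 1 → γ s ≠ γ t := by
    intro s hst hlt heq
    obtain ⟨k, hk⟩ := hγ.injective_mod heq
    rw [hk] at hlt
    have hk0 : k = 0 := by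
      rw [← Int.abs_lt_one_iff]
      exact_mod_cast hlt
    rw [hk0, Int.cast_zero, sub_eq_zero] at hk
    exact hst hk
  have a1 : |t - d - t| = d := by rw [sub_sub_cancel_left, abs_neg, abs_of_pos hd0]
  have a2 : |t + d - t| = d := by rw [add_sub_cancel_left, abs_of_pos hd0]
  have h := hshort (γ (t - d)) (hγ.2.2.2.1 _) (γ (t + d)) (hγ.2.2.2.1 _)
    (hclose _ (by rw [Real.dist_eq, a1]; exact hdδ)) (hclose _ (by rw [Real.dist_eq, a2]; exact hdδ))
    (hne _ (by linarith) (by rwa [a1])) (hne _ (by linarith) (by rwa [a2]))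
  rw [← hgeo _ ⟨by linarith, by linarith⟩ _ ⟨by linarith, by linarith⟩ (by linarith),
    ← eVariationOn.Icc_add_Icc_univ γ (b := t) (by linarith) (by linarith)] at h
  refine h.not_ge (add_le_add ?_ ?_)
  · exact eVariationOn.edist_le γ ⟨le_rfl, by linarith⟩ ⟨by linarith, le_rfl⟩
  · exact eVariationOn.edist_le γ ⟨le_rfl, by linarith⟩ ⟨by linarith, le_rfl⟩

end Chart

section Straighten

variable {K : Set E3} {T : Finset (E3 × ℝ)}

/-- Parametrized by arc length, a closed geodesic is straight in suitable charts. -/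
theorem IsSimpleClosedGeodesicIn.exists_straight_charts (hT0 : ∀ i ∈ T, i.1 ≠ 0)
    (hT : ∀ x, x ∈ K ↔ ∀ i ∈ T, inner ℝ i.1 x ≤ i.2) {o : E3} (ho : o ∈ interior K) {γ : ℝ → E3}
    (hγ : IsSimpleClosedGeodesicIn (frontier K) γ) :
    ∃ (ℓ : ℝ) (β : ℝ → E3), 0 < ℓ ∧ ENNReal.ofReal ℓ = eVariationOn γ (Set.Icc 0 1) ∧
      Function.Periodic β ℓ ∧ (∀ σ σ', β σ = β σ' → ∃ k : ℤ, σ - σ' = k * ℓ) ∧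
      ∀ σ₀, ∃ G W ρ, IsChartAt (frontier K) o β G W σ₀ ρ := by
  obtain ⟨hcont, hper, -, hmem, hpos, hfin, -⟩ := id hγ
  obtain ⟨s, hmono, hlen, hsper⟩ := hper.exists_arclength hfin
  set ℓ := (eVariationOn γ (Set.Icc 0 1)).toReal with hℓ
  have hℓpos : 0 < ℓ := ENNReal.toReal_pos hpos.ne' hfin.ne
  -- folded charts around each point of the curve
  have hchart : ∀ t₀, ∃ e a b : E3, ∃ r > 0, ∃ ε > 0, ‖e‖ = 1 ∧ ‖a‖ = 1 ∧ ‖b‖ = 1 ∧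
      inner ℝ e a = 0 ∧ inner ℝ e b = 0 ∧
      tripleProduct e a (o - γ t₀) < 0 ∧ tripleProduct e b (o - γ t₀) < 0 ∧
      (∀ ζ η : ℂ, ‖ζ‖ < r → ‖η‖ < r → pathDist (frontier K) (foldMap (γ t₀) e a b ζ)
        (foldMap (γ t₀) e a b η) = edist ζ η) ∧
      (∀ ζ : ℂ, ‖ζ‖ < r → foldMap (γ t₀) e a b ζ ∈ frontier K) ∧
      (∀ x ∈ frontier K, dist x (γ t₀) < r → ∃ ζ, foldMap (γ t₀) e a b ζ = x) ∧
      (∀ t ∈ Set.Ioo (t₀ - ε) (t₀ + ε), dist (γ t) (γ t₀) < r) ∧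
      ∀ t₁ ∈ Set.Ioo (t₀ - ε) (t₀ + ε), ∀ t₂ ∈ Set.Ioo (t₀ - ε) (t₀ + ε),
        ENNReal.ofReal |s t₁ - s t₂| = pathDist (frontier K) (γ t₁) (γ t₂) := by
    intro t₀
    obtain ⟨e, he, hact⟩ := hγ.exists_edge_direction hT0 hT t₀
    obtain ⟨a, b, f, r, hr, ha, hb, hea, heb, hfe, hfa, hfb, hF, hsurj, hda, hdb⟩ :=
      exists_foldMap_frontier hT0 hT ho (hmem t₀) he hact
    obtain ⟨ε, hε, hgeo⟩ := hγ.exists_eVariationOn_eq_pathDist t₀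
    obtain ⟨δ, hδ, hclose⟩ := Metric.continuous_iff.1 hcont t₀ r hr
    have hiso : ∀ ζ η : ℂ, ‖ζ‖ < r → ‖η‖ < r → pathDist (frontier K) (foldMap (γ t₀) e a b ζ)
        (foldMap (γ t₀) e a b η) = edist ζ η := fun ζ η hζ hη =>
      pathDist_foldMap_eq_edist he ha hb hea heb hfe hfa hfb hF hsurj hζ hη
    have hdist : ∀ t ∈ Set.Ioo (t₀ - min ε δ) (t₀ + min ε δ), dist (γ t) (γ t₀) < r := by
      intro t ht
      refine hclose t ?_
      rw [Real.dist_eq, abs_lt]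
      have := min_le_right ε δ
      constructor <;> linarith [ht.1, ht.2]
    have hle : ∀ t₁ ∈ Set.Ioo (t₀ - min ε δ) (t₀ + min ε δ),
        ∀ t₂ ∈ Set.Ioo (t₀ - min ε δ) (t₀ + min ε δ), t₁ ≤ t₂ →
        ENNReal.ofReal (s t₂ - s t₁) = pathDist (frontier K) (γ t₁) (γ t₂) := by
      intro t₁ h₁ t₂ h₂ h₁₂
      have := min_le_left ε δ
      rw [← hlen t₁ t₂ h₁₂]
      exact hgeo t₁ ⟨by linarith [h₁.1], by linarith [h₁.2]⟩ t₂
        ⟨by linarith [h₂.1], by linarith [h₂.2]⟩ h₁₂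
    have hsymm : ∀ t₁ ∈ Set.Ioo (t₀ - min ε δ) (t₀ + min ε δ),
        ∀ t₂ ∈ Set.Ioo (t₀ - min ε δ) (t₀ + min ε δ),
        pathDist (frontier K) (γ t₁) (γ t₂) = pathDist (frontier K) (γ t₂) (γ t₁) := by
      intro t₁ h₁ t₂ h₂
      obtain ⟨ζ, hζ⟩ := hsurj (γ t₁) (hmem t₁) ((hdist t₁ h₁).trans (by linarith))
      obtain ⟨η, hη⟩ := hsurj (γ t₂) (hmem t₂) ((hdist t₂ h₂).trans (by linarith))
      have hζr : ‖ζ‖ < r := by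
        rw [← dist_foldMap_self (p := γ t₀) he ha hb hea heb, hζ]; exact hdist t₁ h₁
      have hηr : ‖η‖ < r := by
        rw [← dist_foldMap_self (p := γ t₀) he ha hb hea heb, hη]; exact hdist t₂ h₂
      rw [← hζ, ← hη, hiso _ _ hζr hηr, hiso _ _ hηr hζr, edist_comm]
    refine ⟨e, a, b, r, hr, min ε δ, lt_min hε hδ, he, ha, hb, hea, heb, hda, hdb, hiso,
      fun ζ hζ => hF ζ (by linarith), fun x hx hxr => hsurj x hx (by linarith), hdist,
      fun t₁ h₁ t₂ h₂ => ?_⟩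
    rcases le_total t₁ t₂ with h | h
    · rw [abs_sub_comm, abs_of_nonneg (sub_nonneg.2 (hmono h)), hle t₁ h₁ t₂ h₂ h]
    · rw [abs_of_nonneg (sub_nonneg.2 (hmono h)), hle t₂ h₂ t₁ h₁ h, hsymm t₁ h₁ t₂ h₂]
  -- the developed curve is isometric
  have hdev : ∀ t₀, ∃ e a b : E3, ∃ r > 0, ∃ ε > 0, ∃ z : ℝ → ℂ,
      ‖e‖ = 1 ∧ ‖a‖ = 1 ∧ ‖b‖ = 1 ∧ inner ℝ e a = 0 ∧ inner ℝ e b = 0 ∧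
      tripleProduct e a (o - γ t₀) < 0 ∧ tripleProduct e b (o - γ t₀) < 0 ∧
      (∀ ζ η : ℂ, ‖ζ‖ < r → ‖η‖ < r → pathDist (frontier K) (foldMap (γ t₀) e a b ζ)
        (foldMap (γ t₀) e a b η) = edist ζ η) ∧
      (∀ ζ : ℂ, ‖ζ‖ < r → foldMap (γ t₀) e a b ζ ∈ frontier K) ∧
      (∀ x ∈ frontier K, dist x (γ t₀) < r → ∃ ζ, foldMap (γ t₀) e a b ζ = x) ∧
      z t₀ = 0 ∧
      ∀ t ∈ Set.Ioo (t₀ - ε) (t₀ + ε), foldMap (γ t₀) e a b (z t) = γ t ∧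
        ‖z t‖ = dist (γ t) (γ t₀) ∧
        ∀ t' ∈ Set.Ioo (t₀ - ε) (t₀ + ε), dist (z t) (z t') = |s t - s t'| := by
    intro t₀
    obtain ⟨e, a, b, r, hr, ε, hε, he, ha, hb, hea, heb, hda, hdb, hiso, hF, hsurj, hdist, hs⟩ :=
      hchart t₀
    have hex : ∀ t, ∃ ζ : ℂ, t ∈ Set.Ioo (t₀ - ε) (t₀ + ε) → foldMap (γ t₀) e a b ζ = γ t := by
      intro t
      by_cases ht : t ∈ Set.Ioo (t₀ - ε) (t₀ + ε)
      · obtain ⟨ζ, hζ⟩ := hsurj (γ t) (hmem t) (hdist t ht)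
        exact ⟨ζ, fun _ => hζ⟩
      · exact ⟨0, fun h => absurd h ht⟩
    choose z hz using hex
    have hnorm : ∀ t ∈ Set.Ioo (t₀ - ε) (t₀ + ε), ‖z t‖ = dist (γ t) (γ t₀) := by
      intro t ht
      rw [← dist_foldMap_self (p := γ t₀) he ha hb hea heb, hz t ht]
    refine ⟨e, a, b, r, hr, ε, hε, z, he, ha, hb, hea, heb, hda, hdb, hiso, hF, hsurj, ?_,
      fun t ht => ⟨hz t ht, hnorm t ht, fun t' ht' => ?_⟩⟩
    · rw [← norm_eq_zero, hnorm t₀ ⟨by linarith, by linarith⟩, dist_self]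
    · have h1 := hs t ht t' ht'
      rw [← hz t ht, ← hz t' ht', hiso _ _ (by rw [hnorm t ht]; exact hdist t ht)
        (by rw [hnorm t' ht']; exact hdist t' ht'), edist_dist,
        ENNReal.ofReal_eq_ofReal_iff (abs_nonneg _) dist_nonneg] at h1
      exact h1.symm
  have hstrict : StrictMono s := by
    intro t₁ t₂ h₁₂
    refine lt_of_le_of_ne (hmono h₁₂.le) fun heq => ?_
    obtain ⟨t, ht₁, ht⟩ := exists_between (show t₁ < min t₂ (t₁ + 1) from lt_min h₁₂ (by linarith))
    rw [lt_min_iff] at ht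
    have hst : s t = s t₁ :=
      le_antisymm ((hmono ht.1.le).trans heq.ge) (hmono ht₁.le)
    have h0 : edist (γ t₁) (γ t) ≤ 0 := by
      have := eVariationOn.edist_le γ (s := Set.Icc t₁ t) ⟨le_rfl, ht₁.le⟩ ⟨ht₁.le, le_rfl⟩
      rwa [hlen _ _ ht₁.le, hst, sub_self, ENNReal.ofReal_zero] at this
    obtain ⟨k, hk⟩ := hγ.injective_mod (edist_le_zero.1 h0).symm
    have hk0 : (0 : ℝ) < k := by linarith
    have hk1 : (k : ℝ) < 1 := by linarith [ht.2]
    have : 0 < k := by exact_mod_cast hk0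
    have : k < 1 := by exact_mod_cast hk1
    omega
  have hscont : Continuous s := by
    refine continuous_iff_continuousAt.2 fun t₀ => ?_
    obtain ⟨e, a, b, r, hr, ε, hε, z, -, -, -, -, -, -, -, -, -, -, hz0, hz⟩ := hdev t₀
    have ht₀ : t₀ ∈ Set.Ioo (t₀ - ε) (t₀ + ε) := ⟨by linarith, by linarith⟩
    rw [ContinuousAt, tendsto_iff_dist_tendsto_zero]
    have h1 := tendsto_iff_dist_tendsto_zero.1 (hcont.tendsto t₀)
    refine h1.congr' ?_
    filter_upwards [isOpen_Ioo.mem_nhds ht₀] with t ht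
    obtain ⟨-, h2, h3⟩ := hz t ht
    rw [Real.dist_eq, ← h3 t₀ ht₀, hz0, dist_zero_right, h2]
  have hsint : ∀ (t : ℝ) (k : ℤ), s (t + k) = s t + k * ℓ := by
    intro t k
    induction k with
    | zero => simp
    | succ n ih =>
      push_cast at ih ⊢
      rw [← add_assoc, hsper, ih]; ring
    | pred n ih =>
      have := hsper (t + (-(n : ℝ) - 1))
      push_cast at ih ⊢
      rw [show t + (-(n : ℝ) - 1) + 1 = t + -n by ring, ih] at this
      linarith
  have hssurj : ∀ σ, ∃ t, s t = σ := by
    intro σ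
    refine mem_range_of_exists_le_of_exists_ge hscont ?_ ?_
    · refine ⟨0 + ⌊(σ - s 0) / ℓ⌋, ?_⟩
      rw [hsint]
      have := Int.floor_le ((σ - s 0) / ℓ)
      rw [le_div_iff₀ hℓpos] at this
      linarith
    · refine ⟨0 + ⌈(σ - s 0) / ℓ⌉, ?_⟩
      rw [hsint]
      have := Int.le_ceil ((σ - s 0) / ℓ)
      rw [div_le_iff₀ hℓpos] at this
      linarith
  choose τ hτ using hssurj
  refine ⟨ℓ, γ ∘ τ, hℓpos, ENNReal.ofReal_toReal hfin.ne, fun σ => ?_, fun σ σ' h => ?_,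
    fun σ₀ => ?_⟩
  · have : τ (σ + ℓ) = τ σ + 1 := hstrict.injective (by rw [hτ, hsper, hτ])
    rw [Function.comp_apply, this, hper]; rfl
  · obtain ⟨k, hk⟩ := hγ.injective_mod h
    refine ⟨k, ?_⟩
    have := hsint (τ σ') k
    rw [← hk, add_sub_cancel, hτ, hτ] at this
    rw [← hk]
    linarith
  obtain ⟨e, a, b, r, hr, ε, hε, z, he, ha, hb, hea, heb, hda, hdb, hiso, hF, hsurj, hz0, hz⟩ :=
    hdev (τ σ₀)
  obtain ⟨c, hc0, hc⟩ := exists_between (show 0 < min (s (τ σ₀ + ε) - σ₀) (σ₀ - s (τ σ₀ - ε)) by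
    have h1 := hstrict (show τ σ₀ < τ σ₀ + ε by linarith)
    have h2 := hstrict (show τ σ₀ - ε < τ σ₀ by linarith)
    rw [hτ] at h1 h2
    exact lt_min (by linarith) (by linarith))
  rw [lt_min_iff] at hc
  have hτmem : ∀ x ∈ Set.Icc (-c) c, τ (σ₀ + x) ∈ Set.Ioo (τ σ₀ - ε) (τ σ₀ + ε) := by
    intro x hx
    constructor
    · rw [← hstrict.lt_iff_lt, hτ]; linarith [hx.1]
    · rw [← hstrict.lt_iff_lt, hτ]; linarith [hx.2]
  obtain ⟨u, hu1, hu⟩ := exists_unit_smul_of_isometric (f := fun x => z (τ (σ₀ + x))) hc0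
    (by simpa using hz0) (fun x hx y hy => by
      rw [(hz _ (hτmem x hx)).2.2 _ (hτmem y hy), hτ, hτ]
      congr 1
      ring)
  have hu0 : u ≠ 0 := by
    rintro rfl
    simp at hu1
  set φ := foldMap (γ (τ σ₀)) e a b with hφ
  have hnorm : ∀ ζ : ℂ, ‖u * (ζ - σ₀)‖ = dist ζ σ₀ := by
    intro ζ
    rw [norm_mul, hu1, one_mul, dist_eq_norm]
  refine ⟨fun ζ => φ (u * (ζ - σ₀)), Metric.ball (σ₀ : ℂ) (min r c), min r c, ?_⟩
  have hlt : ∀ ζ ∈ Metric.ball (σ₀ : ℂ) (min r c), ‖u * (ζ - σ₀)‖ < r := by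
    intro ζ hζ
    rw [hnorm]
    exact (Metric.mem_ball.1 hζ).trans_le (min_le_left _ _)
  refine ⟨lt_min hr hc0, fun ζ hζ η hη => ?_, fun ζ hζ => hF _ (hlt ζ hζ), fun σ hσ => ?_, ?_,
    subset_rfl, fun x hx hxr => ?_⟩
  · rw [hiso _ _ (hlt ζ hζ) (hlt η hη), edist_dist, edist_dist]
    congr 1
    rw [dist_eq_norm, ← mul_sub, norm_mul, hu1, one_mul, sub_sub_sub_cancel_right, dist_eq_norm]
  · have hσc : |σ - σ₀| < c := by
      have := (Metric.mem_ball.1 hσ).trans_le (min_le_right r c)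
      rwa [Complex.dist_of_im_eq (by simp), Complex.ofReal_re, Complex.ofReal_re,
        Real.dist_eq] at this
    have hm : σ - σ₀ ∈ Set.Icc (-c) c := abs_le.1 hσc.le
    have h1 := hu _ hm
    have h2 := (hz _ (hτmem _ hm)).1
    simp only [add_sub_cancel] at h1 h2
    rw [h1] at h2
    rw [Function.comp_apply, ← h2, hφ]
    congr 1
    rw [Complex.real_smul]
    push_cast
    ring
  · obtain ⟨hDo, hDd⟩ := isOpen_dense_im_ne_zero hu0 σ₀
    exact ⟨_, hDo, hDd, fun ζ hζ => (isOrientedAt_foldMap hda hdb hζ).comp_mul_sub hu0⟩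
  · obtain ⟨ζ, hζ⟩ := hsurj x hx (hxr.trans_le (min_le_left _ _))
    have hζn : ‖ζ‖ < min r c := by
      rw [← dist_foldMap_self (p := γ (τ σ₀)) he ha hb hea heb, ← hφ, hζ]
      exact hxr
    have hinv : u * (σ₀ + u⁻¹ * ζ - σ₀) = ζ := by
      rw [add_sub_cancel_left, mul_inv_cancel_left₀ hu0]
    refine ⟨σ₀ + u⁻¹ * ζ, ?_, ?_⟩
    · rw [Metric.mem_ball, ← hnorm, hinv]
      exact hζn
    · rw [hinv, hζ]

end Straighten

section Charts

namespace IsChartAt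

variable {F : Set E3} {o : E3} {β : ℝ → E3} {G G₀ G₁ : ℂ → E3} {W W₀ W₁ : Set ℂ} {σ₀ σ₁ ρ : ℝ}

theorem dist_le (h : IsChartAt F o β G W σ₀ ρ) {ζ η : ℂ} (hζ : ζ ∈ W) (hη : η ∈ W) :
    dist (G ζ) (G η) ≤ dist ζ η := by
  have := edist_le_pathDist (F := F) (x := G ζ) (y := G η)
  rw [h.isom ζ hζ η hη] at this
  rwa [edist_dist, edist_dist, ENNReal.ofReal_le_ofReal_iff dist_nonneg] at this

theorem mem_of_abs_lt (h : IsChartAt F o β G W σ₀ ρ) {σ : ℝ} (hσ : |σ - σ₀| < ρ) :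
    (σ : ℂ) ∈ W := by
  refine h.ball_subset ?_
  rwa [Metric.mem_ball, Complex.dist_of_im_eq (by simp), Complex.ofReal_re, Complex.ofReal_re,
    Real.dist_eq]

theorem dist_curve_le (h : IsChartAt F o β G W σ₀ ρ) {ζ : ℂ} (hζ : ζ ∈ W) {σ : ℝ}
    (hσ : |σ - σ₀| < ρ) : dist (G ζ) (β σ) ≤ dist ζ σ := by
  rw [← h.real σ (h.mem_of_abs_lt hσ)]
  exact h.dist_le hζ (h.mem_of_abs_lt hσ)

theorem recenter (h : IsChartAt F o β G W σ₀ ρ) {σ r : ℝ} (hr : 0 < r) (hσ : |σ - σ₀| + r ≤ ρ) :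
    IsChartAt F o β G W σ r := by
  have hd : dist (σ : ℂ) σ₀ = |σ - σ₀| := by
    rw [Complex.dist_of_im_eq (by simp), Complex.ofReal_re, Complex.ofReal_re, Real.dist_eq]
  refine ⟨hr, h.isom, h.mem, h.real, h.oriented, fun ζ hζ => h.ball_subset ?_, fun x hx hxr => ?_⟩
  · rw [Metric.mem_ball] at hζ ⊢
    linarith [dist_triangle ζ σ σ₀]
  · refine h.surj x hx ?_
    have h1 := h.dist_curve_le (h.mem_of_abs_lt (σ := σ) (by linarith)) (σ := σ₀)
      (by rw [sub_self, abs_zero]; exact h.pos)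
    rw [h.real σ (h.mem_of_abs_lt (by linarith)), hd] at h1
    linarith [dist_triangle x (β σ) (β σ₀)]

theorem translate (h : IsChartAt F o β G W σ₀ ρ) {c : ℝ} (hc : Function.Periodic β c) :
    IsChartAt F o β (fun ζ => G (ζ - c)) {ζ | ζ - c ∈ W} (σ₀ + c) ρ := by
  refine ⟨h.pos, fun ζ hζ η hη => ?_, fun ζ hζ => h.mem _ hζ, fun σ hσ => ?_, ?_, fun ζ hζ => ?_,
    fun x hx hxr => ?_⟩
  · rw [h.isom _ hζ _ hη, edist_sub_right]
  · have hσ' : ((σ - c : ℝ) : ℂ) ∈ W := by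
      rw [Complex.ofReal_sub]
      exact hσ
    have := h.real _ hσ'
    rw [Complex.ofReal_sub] at this
    rw [this, hc.sub_eq]
  · obtain ⟨D, hDo, hDd, hD⟩ := h.oriented
    refine ⟨(fun ζ => ζ - (c : ℂ)) ⁻¹' D, hDo.preimage (by fun_prop),
      hDd.preimage (Homeomorph.subRight (c : ℂ)).isOpenMap, fun ζ hζ => ?_⟩
    have := IsOrientedAt.comp_mul_sub (φ := G) (u := 1) (s := c) (ζ := ζ) one_ne_zero
      (by rw [one_mul]; exact hD _ hζ)
    simpa only [one_mul] using this
  · refine h.ball_subset ?_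
    rw [Metric.mem_ball] at hζ ⊢
    rw [dist_eq_norm] at hζ ⊢
    push_cast at hζ
    rwa [sub_sub, add_comm (c : ℂ)]
  · rw [hc] at hxr
    obtain ⟨ζ, hζ, hx⟩ := h.surj x hx hxr
    exact ⟨ζ + c, by simpa using hζ, by simpa using hx⟩

end IsChartAt

variable {F : Set E3} {o : E3} {β : ℝ → E3}

theorem exists_uniform_radius_isChartAt {ℓ : ℝ} (hℓ : 0 < ℓ) (hβ : Function.Periodic β ℓ)
    (h : ∀ σ₀, ∃ G W ρ, IsChartAt F o β G W σ₀ ρ) :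
    ∃ δ > 0, ∀ σ, ∃ G W, IsChartAt F o β G W σ δ := by
  choose G W ρ hG using h
  obtain ⟨δ, hδ, hcov⟩ := lebesgue_number_lemma_of_metric (isCompact_Icc (a := 0) (b := ℓ))
    (c := fun σ => Metric.ball σ (ρ σ)) (fun _ => Metric.isOpen_ball)
    (fun σ _ => Set.mem_iUnion.2 ⟨σ, Metric.mem_ball_self (hG σ).pos⟩)
  have key : ∀ σ ∈ Set.Icc 0 ℓ, ∃ G W, IsChartAt F o β G W σ (δ / 2) := by
    intro σ hσ
    obtain ⟨σ₀, hσ₀⟩ := hcov σ hσ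
    refine ⟨G σ₀, W σ₀, (hG σ₀).recenter (by linarith) ?_⟩
    have h1 := hσ₀ (show σ + δ / 2 ∈ _ by
      rw [Metric.mem_ball, Real.dist_eq, add_sub_cancel_left, abs_of_pos] <;> linarith)
    have h2 := hσ₀ (show σ - δ / 2 ∈ _ by
      rw [Metric.mem_ball, Real.dist_eq, sub_sub_cancel_left, abs_neg, abs_of_pos] <;> linarith)
    rw [Metric.mem_ball, Real.dist_eq, abs_lt] at h1 h2
    rcases abs_cases (σ - σ₀) with h | h <;> linarith
  refine ⟨δ / 2, by linarith, fun σ => ?_⟩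
  have hf := Int.floor_le (σ / ℓ)
  have hf' := Int.lt_floor_add_one (σ / ℓ)
  rw [le_div_iff₀ hℓ] at hf
  rw [div_lt_iff₀ hℓ] at hf'
  obtain ⟨G, W, hGW⟩ := key (σ - ⌊σ / ℓ⌋ * ℓ) ⟨by linarith, by linarith⟩
  have := hGW.translate (hβ.int_mul ⌊σ / ℓ⌋)
  rw [sub_add_cancel] at this
  exact ⟨_, _, this⟩

end Charts

section Agreement

theorem eq_of_eventually_affine_eq {p u v u' v' : E3} {ζ : ℂ}
    (h : ∀ᶠ η in nhds ζ, p + (η - ζ).re • u + (η - ζ).im • v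
      = p + (η - ζ).re • u' + (η - ζ).im • v') : u = u' ∧ v = v' := by
  obtain ⟨ε, hε, hball⟩ := Metric.eventually_nhds_iff.1 h
  have hε2 : (ε / 2 : ℝ) ≠ 0 := by positivity
  have hn : ‖((ε / 2 : ℝ) : ℂ)‖ < ε := by
    rw [Complex.norm_real, Real.norm_eq_abs, abs_of_pos (by linarith)]
    linarith
  constructor
  · have := @hball (ζ + (ε / 2 : ℝ)) (by rwa [dist_eq_norm, add_sub_cancel_left])
    rw [add_sub_cancel_left, Complex.ofReal_re, Complex.ofReal_im] at this
    simpa [hε.ne'] using this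
  · have := @hball (ζ + (ε / 2 : ℝ) * Complex.I) (by
      rwa [dist_eq_norm, add_sub_cancel_left, norm_mul, Complex.norm_I, mul_one])
    rw [add_sub_cancel_left, Complex.re_ofReal_mul, Complex.im_ofReal_mul] at this
    simpa [hε.ne'] using this

theorem not_isOrientedAt_conj {o : E3} {G₀ G₁ : ℂ → E3} {ζ : ℂ} (h₀ : IsOrientedAt o G₀ ζ)
    (h₁ : IsOrientedAt o G₁ (starRingEnd ℂ ζ))
    (h : ∀ᶠ η in nhds ζ, G₀ η = G₁ (starRingEnd ℂ η)) : False := by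
  obtain ⟨u, v, hev, hdet⟩ := h₀
  obtain ⟨u', v', hev', hdet'⟩ := h₁
  have hζ := h.self_of_nhds
  have hc : Filter.Tendsto (starRingEnd ℂ) (nhds ζ) (nhds (starRingEnd ℂ ζ)) :=
    Complex.continuous_conj.tendsto ζ
  obtain ⟨rfl, hv⟩ := eq_of_eventually_affine_eq (p := G₀ ζ) (u := u) (v := v) (u' := u')
    (v' := -v') (ζ := ζ) (by
      filter_upwards [hev, hc.eventually hev', h] with η h1 h2 h3
      rw [← h1, h3, h2, hζ, ← map_sub, Complex.conj_re, Complex.conj_im, neg_smul, smul_neg])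
  rw [← hζ] at hdet'
  have : tripleProduct u v (o - G₀ ζ) = -tripleProduct u v' (o - G₀ ζ) := by
    rw [hv]
    simp only [tripleProduct, PiLp.neg_apply]
    ring
  linarith

theorem eq_or_eq_conj_of_dist_eq {ζ ξ : ℂ} {c : ℝ} (hc : c ≠ 0)
    (h₀ : dist ξ (ζ.re : ℂ) = dist ζ (ζ.re : ℂ))
    (h₁ : dist ξ ((ζ.re + c : ℝ) : ℂ) = dist ζ ((ζ.re + c : ℝ) : ℂ)) :
    ξ = ζ ∨ ξ = starRingEnd ℂ ζ := by
  have sq : ∀ z w : ℂ, dist z w ^ 2 = (z.re - w.re) ^ 2 + (z.im - w.im) ^ 2 := by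
    intro z w
    rw [Complex.dist_eq_re_im, Real.sq_sqrt (by positivity)]
  have e₀ := congrArg (· ^ 2) h₀
  have e₁ := congrArg (· ^ 2) h₁
  simp only [sq, Complex.ofReal_re, Complex.ofReal_im, sub_zero] at e₀ e₁
  have hre : ξ.re = ζ.re := by
    have : c * (ξ.re - ζ.re) = 0 := by nlinarith
    linarith [(mul_eq_zero.1 this).resolve_left hc]
  have him : (ξ.im - ζ.im) * (ξ.im + ζ.im) = 0 := by
    rw [hre] at e₀
    nlinarith
  rcases mul_eq_zero.1 him with h | h
  · exact Or.inl (Complex.ext hre (by linarith))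
  · exact Or.inr (Complex.ext hre (by rw [Complex.conj_im]; linarith))

/-- Two charts developing the same curve agree where their discs of half radius meet. -/
theorem IsChartAt.eq_of_dist_lt {F : Set E3} {o : E3} {β : ℝ → E3} {G₀ G₁ : ℂ → E3}
    {W₀ W₁ : Set ℂ} {σ₀ σ₁ δ : ℝ} (h₀ : IsChartAt F o β G₀ W₀ σ₀ δ)
    (h₁ : IsChartAt F o β G₁ W₁ σ₁ δ) {ζ : ℂ} (hζ₀ : dist ζ σ₀ < δ / 2)
    (hζ₁ : dist ζ σ₁ < δ / 2) : G₀ ζ = G₁ ζ := by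
  set Ω : Set ℂ := Metric.ball (σ₀ : ℂ) (δ / 2) ∩ Metric.ball (σ₁ : ℂ) (δ / 2) with hΩ
  have hΩo : IsOpen Ω := Metric.isOpen_ball.inter Metric.isOpen_ball
  have hδ := h₀.pos
  have hW₀ : ∀ ξ ∈ Ω, ξ ∈ W₀ := fun ξ hξ =>
    h₀.ball_subset (Metric.ball_subset_ball (by linarith) hξ.1)
  have hW₁ : ∀ ξ ∈ Ω, ξ ∈ W₁ := fun ξ hξ =>
    h₁.ball_subset (Metric.ball_subset_ball (by linarith) hξ.2)
  have hre : ∀ ξ : ℂ, ∀ σ : ℝ, |ξ.re - σ| ≤ dist ξ σ := by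
    intro ξ σ
    have := Complex.abs_re_le_norm (ξ - σ)
    rwa [Complex.sub_re, Complex.ofReal_re, ← dist_eq_norm] at this
  have him : ∀ ξ : ℂ, dist ξ ξ.re = |ξ.im| := by
    intro ξ
    rw [Complex.dist_of_re_eq (by simp), Complex.ofReal_im, Real.dist_eq, sub_zero]
  have himle : ∀ ξ : ℂ, ∀ σ : ℝ, |ξ.im| ≤ dist ξ σ := by
    intro ξ σ
    have := Complex.abs_im_le_norm (ξ - σ)
    rwa [Complex.sub_im, Complex.ofReal_im, sub_zero, ← dist_eq_norm] at this
  have hreal : ∀ σ : ℝ, (σ : ℂ) ∈ Ω → G₀ σ = G₁ σ := fun σ hσ => by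
    rw [h₀.real σ (hW₀ _ hσ), h₁.real σ (hW₁ _ hσ)]
  have hreΩ : ∀ ξ ∈ Ω, (ξ.re : ℂ) ∈ Ω := by
    intro ξ hξ
    have a := (hre ξ σ₀).trans_lt hξ.1
    have b := (hre ξ σ₁).trans_lt hξ.2
    constructor <;>
    rwa [Metric.mem_ball, Complex.dist_of_im_eq (by simp), Complex.ofReal_re, Complex.ofReal_re,
      Real.dist_eq]
  have hT : ∀ ξ, ∃ ξ', ξ ∈ Ω → ξ' ∈ W₁ ∧ G₁ ξ' = G₀ ξ := by
    intro ξ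
    by_cases hξ : ξ ∈ Ω
    · have hσ := hreΩ ξ hξ
      obtain ⟨ξ', h, h'⟩ := h₁.surj (G₀ ξ) (h₀.mem _ (hW₀ _ hξ)) (by
        have e1 := h₀.dist_le (hW₀ _ hξ) (hW₀ _ hσ)
        have e2 := h₁.dist_curve_le (hW₁ _ hσ) (σ := σ₁) (by rw [sub_self, abs_zero]; exact hδ)
        rw [← hreal _ hσ] at e2
        rw [him] at e1
        have e3 := (himle ξ σ₁).trans_lt hξ.2
        have e4 : dist (ξ.re : ℂ) σ₁ < δ / 2 := hσ.2
        linarith [dist_triangle (G₀ ξ) (G₀ ξ.re) (β σ₁)])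
      exact ⟨ξ', fun _ => ⟨h, h'⟩⟩
    · exact ⟨0, fun h => absurd h hξ⟩
  choose R hR using hT
  have hiso : ∀ ξ ∈ Ω, ∀ η ∈ Ω, dist (R ξ) (R η) = dist ξ η := by
    intro ξ hξ η hη
    have a := h₁.isom _ (hR ξ hξ).1 _ (hR η hη).1
    rw [(hR ξ hξ).2, (hR η hη).2, h₀.isom _ (hW₀ _ hξ) _ (hW₀ _ hη)] at a
    rw [dist_edist, dist_edist, a]
  have hfix : ∀ σ : ℝ, (σ : ℂ) ∈ Ω → R σ = σ := by
    intro σ hσ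
    have a := h₁.isom _ (hR σ hσ).1 _ (hW₁ _ hσ)
    rw [(hR σ hσ).2, hreal σ hσ, pathDist_self (h₁.mem _ (hW₁ _ hσ))] at a
    exact edist_eq_zero.1 a.symm
  have halt : ∀ ξ ∈ Ω, R ξ = ξ ∨ R ξ = starRingEnd ℂ ξ := by
    intro ξ hξ
    have hσ := hreΩ ξ hξ
    obtain ⟨ε, hε, hball⟩ := Metric.isOpen_iff.1 hΩo _ hσ
    have hc : ((ξ.re + ε / 2 : ℝ) : ℂ) ∈ Ω := by
      refine hball ?_
      rw [Metric.mem_ball, Complex.dist_of_im_eq (by simp), Complex.ofReal_re, Complex.ofReal_re,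
        Real.dist_eq, add_sub_cancel_left, abs_of_pos] <;> linarith
    refine eq_or_eq_conj_of_dist_eq (c := ε / 2) (by positivity) ?_ ?_
    · rw [← hiso ξ hξ _ hσ, hfix _ hσ]
    · rw [← hiso ξ hξ _ hc, hfix _ hc]
  have hζ : ζ ∈ Ω := ⟨hζ₀, hζ₁⟩
  rcases halt ζ hζ with h | h
  · rw [← (hR ζ hζ).2, h]
  by_cases hζim : ζ.im = 0
  · rw [← (hR ζ hζ).2, h, Complex.conj_eq_iff_im.2 hζim]
  exfalso
  set U : Set ℂ := Ω ∩ {ξ | 0 < ξ.im * ζ.im} with hU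
  have hUo : IsOpen U := hΩo.inter (isOpen_lt continuous_const
    (Complex.continuous_im.mul continuous_const))
  have hconj : ∀ ξ ∈ U, R ξ = starRingEnd ℂ ξ := by
    intro ξ hξ
    refine (halt ξ hξ.1).resolve_left fun hξR => ?_
    have e := congrArg (· ^ 2) (hiso ξ hξ.1 ζ hζ)
    simp only [hξR, h, Complex.dist_eq_re_im, Complex.conj_re, Complex.conj_im] at e
    rw [Real.sq_sqrt (by positivity), Real.sq_sqrt (by positivity)] at e
    have : 0 < ξ.im * ζ.im := hξ.2
    nlinarith
  obtain ⟨D₀, hD₀o, hD₀d, hD₀⟩ := h₀.oriented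
  obtain ⟨D₁, hD₁o, hD₁d, hD₁⟩ := h₁.oriented
  have hD₁d' : Dense (starRingEnd ℂ ⁻¹' D₁) :=
    hD₁d.preimage Complex.conjCLE.toHomeomorph.isOpenMap
  obtain ⟨ξ, hξU, hξ₀, hξ₁⟩ := (hD₀d.inter_of_isOpen_left hD₁d' hD₀o).inter_open_nonempty U hUo
    ⟨ζ, hζ, by
      have := mul_self_pos.2 hζim
      exact this⟩
  refine not_isOrientedAt_conj (hD₀ ξ hξ₀) (hD₁ _ hξ₁) ?_
  filter_upwards [hUo.mem_nhds hξU] with η hη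
  rw [← hconj η hη, (hR η hη.1).2]

end Agreement

section Strip

variable {F : Set E3} {o : E3} {β : ℝ → E3} {ℓ : ℝ}

theorem Complex.dist_ofReal_re (ζ : ℂ) : dist ζ ζ.re = |ζ.im| := by
  rw [Complex.dist_of_re_eq (by simp), Complex.ofReal_im, Real.dist_eq, sub_zero]

theorem Complex.dist_ofReal_le (ζ : ℂ) (σ : ℝ) : dist ζ σ ≤ |ζ.im| + |ζ.re - σ| := by
  have h := dist_triangle ζ ζ.re σ
  rwa [Complex.dist_ofReal_re, Complex.dist_of_im_eq (z := (ζ.re : ℂ)) (by simp), Complex.ofReal_re,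
    Complex.ofReal_re, Real.dist_eq] at h

/-- The charts along a closed curve combine to a locally isometric periodic strip. -/
theorem exists_flat_strip (hℓ : 0 < ℓ) (hβ : Function.Periodic β ℓ)
    (h : ∀ σ₀, ∃ G W ρ, IsChartAt F o β G W σ₀ ρ) :
    ∃ κ > 0, ∃ Φ : ℂ → E3, (∀ ζ : ℂ, |ζ.im| < κ → Φ ζ ∈ F) ∧
      (∀ ζ : ℂ, |ζ.im| < κ → Φ (ζ + ℓ) = Φ ζ) ∧
      (∀ ζ η : ℂ, |ζ.im| < κ → |η.im| < κ → |ζ.re - η.re| < κ →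
        pathDist F (Φ ζ) (Φ η) = edist ζ η) ∧ ∀ σ : ℝ, Φ σ = β σ := by
  obtain ⟨δ, hδ, hchart⟩ := exists_uniform_radius_isChartAt hℓ hβ h
  choose G W hG using hchart
  have hmem : ∀ ζ : ℂ, ∀ σ : ℝ, |ζ.im| < δ / 4 → |ζ.re - σ| < δ / 4 → ζ ∈ W σ := by
    intro ζ σ h1 h2
    refine (hG σ).ball_subset (Metric.mem_ball.2 ?_)
    linarith [ζ.dist_ofReal_le σ]
  have hagree : ∀ ζ : ℂ, ∀ σ : ℝ, |ζ.im| < δ / 4 → |ζ.re - σ| < δ / 4 → G ζ.re ζ = G σ ζ := by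
    intro ζ σ h1 h2
    refine (hG _).eq_of_dist_lt (hG σ) ?_ ?_
    · rw [Complex.dist_ofReal_re]
      linarith
    · linarith [ζ.dist_ofReal_le σ]
  have hself : ∀ σ : ℝ, |σ - σ| < δ / 4 := fun σ => by
    rw [sub_self, abs_zero]
    linarith
  refine ⟨δ / 4, by linarith, fun ζ => G ζ.re ζ, fun ζ hζ => (hG _).mem _ (hmem ζ _ hζ (hself _)),
    fun ζ hζ => ?_, fun ζ η hζ hη hζη => ?_, fun σ => ?_⟩
  · have ht := (hG ζ.re).translate hβ
    have hre : (ζ + ℓ).re = ζ.re + ℓ := by simp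
    have hd : dist (ζ + ℓ) ((ζ.re + ℓ : ℝ) : ℂ) < δ / 2 := by
      rw [← hre, Complex.dist_ofReal_re, Complex.add_im, Complex.ofReal_im, add_zero]
      linarith
    have := (hG (ζ.re + ℓ)).eq_of_dist_lt ht hd hd
    beta_reduce
    rw [hre, this, add_sub_cancel_right]
  · beta_reduce
    rw [hagree η ζ.re hη (by rwa [abs_sub_comm])]
    exact (hG _).isom _ (hmem ζ _ hζ (hself _)) _ (hmem η _ hη (by rwa [abs_sub_comm]))
  · beta_reduce
    rw [Complex.ofReal_re]
    exact (hG σ).real σ ((hG σ).mem_of_abs_lt (by rw [sub_self, abs_zero]; exact hδ))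

theorem exists_dist_lt_imp_abs_sub_lt (hℓ : 0 < ℓ) (hc : Continuous β)
    (hβ : Function.Periodic β ℓ) (hinj : ∀ σ σ', β σ = β σ' → ∃ k : ℤ, σ - σ' = k * ℓ) {κ : ℝ}
    (hκ : 0 < κ) : ∃ m > 0, ∀ σ σ', dist (β σ) (β σ') < m → ∃ k : ℤ, |σ - σ' - k * ℓ| < κ := by
  set C : Set (ℝ × ℝ) := (Set.Icc 0 ℓ ×ˢ Set.Icc 0 ℓ) ∩ ⋂ k : ℤ, {p | κ ≤ |p.1 - p.2 - k * ℓ|}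
    with hC
  have hCc : IsCompact C := (isCompact_Icc.prod isCompact_Icc).inter_right
    (isClosed_iInter fun k => isClosed_le continuous_const (by fun_prop))
  have hpos : ∀ p ∈ C, 0 < dist (β p.1) (β p.2) := by
    intro p hp
    refine dist_pos.2 fun h => ?_
    obtain ⟨k, hk⟩ := hinj _ _ h
    have : κ ≤ |p.1 - p.2 - k * ℓ| := Set.mem_iInter.1 hp.2 k
    rw [hk, sub_self, abs_zero] at this
    linarith
  obtain ⟨m, hm, hmC⟩ : ∃ m > 0, ∀ p ∈ C, m ≤ dist (β p.1) (β p.2) := by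
    rcases C.eq_empty_or_nonempty with h | h
    · exact ⟨1, one_pos, by simp [h]⟩
    · obtain ⟨p, hp, hmin⟩ := hCc.exists_isMinOn h
        (f := fun p => dist (β p.1) (β p.2)) (by fun_prop)
      exact ⟨_, hpos p hp, fun q hq => hmin hq⟩
  refine ⟨m, hm, fun σ σ' h => ?_⟩
  by_contra! hcon
  have hmem : ∀ σ : ℝ, σ - ⌊σ / ℓ⌋ * ℓ ∈ Set.Icc 0 ℓ := by
    intro σ
    have hf := Int.floor_le (σ / ℓ)
    have hf' := Int.lt_floor_add_one (σ / ℓ)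
    rw [le_div_iff₀ hℓ] at hf
    rw [div_lt_iff₀ hℓ] at hf'
    constructor <;> linarith
  have := hmC (σ - ⌊σ / ℓ⌋ * ℓ, σ' - ⌊σ' / ℓ⌋ * ℓ) ⟨⟨hmem σ, hmem σ'⟩, Set.mem_iInter.2 fun k => by
    have := hcon (k + ⌊σ / ℓ⌋ - ⌊σ' / ℓ⌋)
    push_cast at this
    refine this.trans (le_of_eq ?_)
    congr 1
    ring⟩
  rw [hβ.sub_int_mul_eq, hβ.sub_int_mul_eq] at this
  linarith

/-- The strip around a simple closed curve can be chosen embedded. -/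
theorem exists_embedded_flat_strip (hℓ : 0 < ℓ) (hβ : Function.Periodic β ℓ)
    (hinj : ∀ σ σ', β σ = β σ' → ∃ k : ℤ, σ - σ' = k * ℓ)
    (h : ∀ σ₀, ∃ G W ρ, IsChartAt F o β G W σ₀ ρ) :
    ∃ κ > 0, ∃ Φ : ℂ → E3, (∀ ζ : ℂ, |ζ.im| < κ → Φ ζ ∈ F) ∧
      (∀ ζ : ℂ, |ζ.im| < κ → Φ (ζ + ℓ) = Φ ζ) ∧
      (∀ ζ η : ℂ, |ζ.im| < κ → |η.im| < κ → |ζ.re - η.re| < κ →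
        pathDist F (Φ ζ) (Φ η) = edist ζ η) ∧
      ∀ ζ η : ℂ, |ζ.im| < κ → |η.im| < κ → Φ ζ = Φ η → ∃ k : ℤ, ζ - η = k * ℓ := by
  obtain ⟨κ, hκ, Φ, hF, hper, hiso, hreal⟩ := exists_flat_strip hℓ hβ h
  have hdist : ∀ ζ η : ℂ, |ζ.im| < κ → |η.im| < κ → |ζ.re - η.re| < κ →
      dist (Φ ζ) (Φ η) ≤ dist ζ η := by
    intro ζ η h1 h2 h3
    have := edist_le_pathDist (F := F) (x := Φ ζ) (y := Φ η)
    rw [hiso ζ η h1 h2 h3] at this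
    rwa [edist_dist, edist_dist, ENNReal.ofReal_le_ofReal_iff dist_nonneg] at this
  have hc : Continuous β := by
    refine Metric.continuous_iff.2 fun σ ε hε => ⟨min ε κ, lt_min hε hκ, fun σ' hσ' => ?_⟩
    have h1 := lt_min_iff.1 hσ'
    rw [← hreal, ← hreal]
    refine (hdist _ _ (by simpa) (by simpa) (by simpa [Real.dist_eq] using h1.2)).trans_lt ?_
    rw [Complex.dist_of_im_eq (by simp), Complex.ofReal_re, Complex.ofReal_re]
    exact h1.1
  obtain ⟨m, hm, hsep⟩ := exists_dist_lt_imp_abs_sub_lt hℓ hc hβ hinj hκ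
  refine ⟨min κ (m / 2), by positivity, Φ, fun ζ hζ => hF ζ (lt_min_iff.1 hζ).1,
    fun ζ hζ => hper ζ (lt_min_iff.1 hζ).1, fun ζ η h1 h2 h3 => hiso ζ η (lt_min_iff.1 h1).1
      (lt_min_iff.1 h2).1 (lt_min_iff.1 h3).1, fun ζ η hζ hη heq => ?_⟩
  rw [lt_min_iff] at hζ hη
  have hre : ∀ ζ : ℂ, |ζ.im| < κ → dist (Φ ζ) (β ζ.re) ≤ |ζ.im| := by
    intro ζ hζ
    rw [← hreal, ← Complex.dist_ofReal_re]
    exact hdist _ _ hζ (by simpa) (by simpa)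
  have hperk : ∀ k : ℤ, Φ (η + k * ℓ) = Φ η := by
    have hp : Function.Periodic (fun x : ℝ => Φ (η + x)) ℓ := by
      intro x
      have := hper (η + x) (by simpa using hη.1)
      beta_reduce
      rw [← this]
      push_cast
      rw [add_assoc]
    intro k
    have := hp.int_mul k 0
    simpa using this
  obtain ⟨k, hk⟩ := hsep ζ.re η.re (by
    have h1 := hre ζ hζ.1
    have h2 := hre η hη.1
    rw [heq] at h1
    have := dist_triangle_left (β ζ.re) (β η.re) (Φ η)
    linarith [hζ.2, hη.2])
  refine ⟨k, ?_⟩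
  have hkre : ((k : ℂ) * ℓ).re = k * ℓ := by simp
  have hkim : ((k : ℂ) * ℓ).im = 0 := by simp
  have := hiso ζ (η + k * ℓ) hζ.1 (by rw [Complex.add_im, hkim, add_zero]; exact hη.1)
    (by rwa [Complex.add_re, hkre, ← sub_sub])
  rw [hperk, ← heq, pathDist_self (hF ζ hζ.1)] at this
  rw [sub_eq_iff_eq_add', ← edist_eq_zero, this]

variable {Φ : ℂ → E3} {κ y : ℝ}

theorem eVariationOn_strip_line (hℓ : 0 < ℓ) (hF : ∀ ζ : ℂ, |ζ.im| < κ → Φ ζ ∈ F)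
    (hiso : ∀ ζ η : ℂ, |ζ.im| < κ → |η.im| < κ → |ζ.re - η.re| < κ →
      pathDist F (Φ ζ) (Φ η) = edist ζ η) (hy : |y| < κ) :
    (Continuous fun t : ℝ => Φ (ℓ * t + y * Complex.I)) ∧
    ∀ s t : ℝ, s ≤ t → ℓ * (t - s) < κ →
      eVariationOn (fun t : ℝ => Φ (ℓ * t + y * Complex.I)) (Set.Icc s t)
        = ENNReal.ofReal (ℓ * (t - s)) ∧
      pathDist F (Φ (ℓ * s + y * Complex.I)) (Φ (ℓ * t + y * Complex.I))
        = ENNReal.ofReal (ℓ * (t - s)) := by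
  set γ : ℝ → E3 := fun t : ℝ => Φ (ℓ * t + y * Complex.I) with hγ
  have him : ∀ t : ℝ, ((ℓ : ℂ) * t + y * Complex.I).im = y := by simp
  have hre : ∀ t : ℝ, ((ℓ : ℂ) * t + y * Complex.I).re = ℓ * t := by simp
  have hκ : 0 < κ := (abs_nonneg y).trans_lt hy
  have hpd : ∀ s t : ℝ, ℓ * |s - t| < κ → pathDist F (γ s) (γ t) = ENNReal.ofReal (ℓ * |s - t|) := by
    intro s t hst
    have habs : |ℓ * s - ℓ * t| = ℓ * |s - t| := by rw [← mul_sub, abs_mul, abs_of_pos hℓ]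
    rw [hγ, hiso _ _ (by rwa [him]) (by rwa [him]) (by rwa [hre, hre, habs]), edist_dist,
      Complex.dist_of_im_eq (by rw [him, him]), hre, hre, Real.dist_eq, habs]
  have hdist : ∀ s t : ℝ, ℓ * |s - t| < κ → dist (γ s) (γ t) ≤ ℓ * |s - t| := by
    intro s t hst
    have := edist_le_pathDist (F := F) (x := γ s) (y := γ t)
    rwa [hpd s t hst, edist_dist, ENNReal.ofReal_le_ofReal_iff (by positivity)] at this
  have hcont : Continuous γ := by
    refine Metric.continuous_iff.2 fun t ε hε => ⟨min ε κ / ℓ, by positivity, fun s hs => ?_⟩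
    rw [Real.dist_eq, lt_div_iff₀ hℓ, mul_comm, lt_min_iff] at hs
    exact (hdist s t hs.2).trans_lt hs.1
  refine ⟨hcont, fun s t hst hlt => ?_⟩
  have habs : |s - t| = t - s := by rw [abs_sub_comm, abs_of_nonneg (sub_nonneg.2 hst)]
  have hp := hpd s t (by rwa [habs])
  rw [habs] at hp
  refine ⟨le_antisymm ?_ ?_, hp⟩
  · have hlip : LipschitzOnWith ℓ.toNNReal γ (Set.Icc s t) := by
      refine LipschitzOnWith.of_dist_le_mul fun x hx x' hx' => ?_
      rw [Real.coe_toNNReal _ hℓ.le, Real.dist_eq]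
      refine hdist x x' (lt_of_le_of_lt ?_ hlt)
      gcongr
      rw [abs_le]
      constructor <;> linarith [hx.1, hx.2, hx'.1, hx'.2]
    refine hlip.eVariationOn_Icc_le.trans (le_of_eq ?_)
    rw [ENNReal.ofReal_mul hℓ.le]
    rfl
  · rw [← hp]
    exact pathDist_le ⟨hst, hcont.continuousOn, rfl, rfl, fun x _ => hF _ (by rwa [him])⟩

theorem isSimpleClosedGeodesicIn_strip_line (hℓ : 0 < ℓ) (hF : ∀ ζ : ℂ, |ζ.im| < κ → Φ ζ ∈ F)
    (hper : ∀ ζ : ℂ, |ζ.im| < κ → Φ (ζ + ℓ) = Φ ζ)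
    (hiso : ∀ ζ η : ℂ, |ζ.im| < κ → |η.im| < κ → |ζ.re - η.re| < κ →
      pathDist F (Φ ζ) (Φ η) = edist ζ η)
    (hinj : ∀ ζ η : ℂ, |ζ.im| < κ → |η.im| < κ → Φ ζ = Φ η → ∃ k : ℤ, ζ - η = k * ℓ)
    (hy : |y| < κ) :
    IsSimpleClosedGeodesicIn F (fun t : ℝ => Φ (ℓ * t + y * Complex.I)) ∧
      eVariationOn (fun t : ℝ => Φ (ℓ * t + y * Complex.I)) (Set.Icc 0 1) = ENNReal.ofReal ℓ := by
  obtain ⟨hcont, hvar⟩ := eVariationOn_strip_line hℓ hF hiso hy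
  set γ : ℝ → E3 := fun t : ℝ => Φ (ℓ * t + y * Complex.I) with hγ
  have him : ∀ t : ℝ, ((ℓ : ℂ) * t + y * Complex.I).im = y := by simp
  have hκ : 0 < κ := (abs_nonneg y).trans_lt hy
  have hlen : eVariationOn γ (Set.Icc 0 1) = ENNReal.ofReal ℓ := by
    obtain ⟨n, hn⟩ := exists_nat_gt (ℓ / κ)
    have hn0 : (0 : ℝ) < n := (by positivity : 0 < ℓ / κ).trans hn
    rw [div_lt_iff₀ hκ] at hn
    have hstep : ∀ j : ℕ, eVariationOn γ (Set.Icc 0 (j / n : ℝ)) = ENNReal.ofReal (ℓ * (j / n)) := by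
      intro j
      induction j with
      | zero => simp [eVariationOn.subsingleton]
      | succ j ih =>
        have hle : (j / n : ℝ) ≤ (j + 1 : ℕ) / n := by
          gcongr
          simp
        have hd : ((j + 1 : ℕ) / n - j / n : ℝ) = 1 / n := by
          push_cast
          ring
        rw [← eVariationOn.Icc_add_Icc_univ γ (b := (j / n : ℝ)) (by positivity) hle, ih,
          (hvar _ _ hle (by rw [hd, mul_one_div, div_lt_iff₀ hn0]; linarith)).1,
          ← ENNReal.ofReal_add (by positivity)
            (mul_nonneg hℓ.le (sub_nonneg.2 hle)), ← mul_add, add_sub_cancel]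
    have := hstep n
    rwa [div_self hn0.ne', mul_one] at this
  refine ⟨⟨hcont, fun t => ?_, fun s hs t ht hst => ?_, fun t => hF _ (by rwa [him]), ?_, ?_,
    fun t => ?_⟩, hlen⟩
  · have := hper (ℓ * t + y * Complex.I) (by rwa [him])
    rw [hγ]
    beta_reduce
    rw [← this]
    congr 1
    push_cast
    ring
  · obtain ⟨k, hk⟩ := hinj _ _ (by rwa [him]) (by rwa [him]) hst
    have hk' := congrArg Complex.re hk
    simp only [Complex.sub_re, Complex.add_re, Complex.re_ofReal_mul, Complex.ofReal_re,
      Complex.I_re, mul_zero, add_zero] at hk'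
    have hkr : ((k : ℂ) * ℓ).re = k * ℓ := by simp
    rw [hkr, ← mul_sub, mul_comm (k : ℝ)] at hk'
    have hst' := mul_left_cancel₀ hℓ.ne' hk'
    have hk0 : k = 0 := by
      rw [← Int.abs_lt_one_iff, ← Int.cast_lt (R := ℝ), Int.cast_abs, ← hst', abs_lt]
      push_cast
      constructor <;> linarith [hs.1, hs.2, ht.1, ht.2]
    rw [hk0, Int.cast_zero, sub_eq_zero] at hst'
    exact hst'
  · rw [hlen]
    exact ENNReal.ofReal_pos.2 hℓ
  · rw [hlen]
    exact ENNReal.ofReal_lt_top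
  · refine ⟨κ / (2 * ℓ), by positivity, fun s₁ s₂ h₁ h₂ h₁₂ a b c hab hc ha hb hcF => ?_⟩
    have hlt : ℓ * (s₂ - s₁) < κ := by
      have : s₂ - s₁ < κ / ℓ := by
        have : κ / ℓ = κ / (2 * ℓ) + κ / (2 * ℓ) := by
          field_simp
          ring
        linarith [h₁.1, h₂.2]
      rwa [lt_div_iff₀ hℓ, mul_comm] at this
    obtain ⟨h1, h2⟩ := hvar s₁ s₂ h₁₂ hlt
    rw [h1, ← h2]
    exact pathDist_le ⟨hab, hc, ha, hb, hcF⟩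

end Strip

/-- If a convex polytope in `ℝ³` admits one simple closed geodesic of length `L`
on its surface, then it admits infinitely many simple closed geodesics of length `L`
with pairwise distinct images. -/
theorem infinitely_many_equivalent_geodesics
    (S K : Set (EuclideanSpace ℝ (Fin 3))) (hS : S.Finite)
    (hK : K = convexHull ℝ S) (hint : (interior K).Nonempty)
    (L : ℝ≥0∞)
    (hex : ∃ γ₀ : ℝ → EuclideanSpace ℝ (Fin 3),
      IsSimpleClosedGeodesicIn (frontier K) γ₀ ∧ eVariationOn γ₀ (Set.Icc 0 1) = L) :
    ∃ G : Set (ℝ → EuclideanSpace ℝ (Fin 3)), G.Infinite ∧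
      (∀ γ ∈ G, IsSimpleClosedGeodesicIn (frontier K) γ ∧
        eVariationOn γ (Set.Icc 0 1) = L) ∧
      Set.InjOn (fun γ => Set.range γ) G := by
  subst hK
  obtain ⟨γ₀, hγ₀, hL⟩ := hex
  obtain ⟨T, hT0, hT⟩ := exists_finset_halfspaces hS hint
  obtain ⟨o, ho⟩ := hint
  obtain ⟨ℓ, β, hℓ, hℓL, hβ, hinj, hchart⟩ := hγ₀.exists_straight_charts hT0 hT ho
  obtain ⟨κ, hκ, Φ, hF, hper, hiso, hΦ⟩ := exists_embedded_flat_strip hℓ hβ hinj hchart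
  set line : ℝ → ℝ → EuclideanSpace ℝ (Fin 3) := fun y t => Φ (ℓ * t + y * Complex.I) with hline
  have habs : ∀ y ∈ Set.Ioo 0 κ, |y| < κ := fun y hy => by
    rw [abs_of_pos hy.1]
    exact hy.2
  have hrange : ∀ y ∈ Set.Ioo 0 κ, ∀ y' ∈ Set.Ioo 0 κ,
      Set.range (line y) = Set.range (line y') → y = y' := by
    intro y hy y' hy' h
    obtain ⟨t, ht⟩ : line y 0 ∈ Set.range (line y') := h ▸ Set.mem_range_self 0
    obtain ⟨k, hk⟩ := hΦ _ _ (by simpa using habs y' hy') (by simpa using habs y hy) ht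
    have := congrArg Complex.im hk
    simp at this
    linarith
  refine ⟨line '' Set.Ioo 0 κ, (Set.Ioo_infinite hκ).image fun y hy y' hy' h =>
    hrange y hy y' hy' (by rw [h]), ?_, ?_⟩
  · rintro _ ⟨y, hy, rfl⟩
    have := isSimpleClosedGeodesicIn_strip_line hℓ hF hper hiso hΦ (habs y hy)
    rwa [hℓL, hL] at this
  · rintro _ ⟨y, hy, rfl⟩ _ ⟨y', hy', rfl⟩ h
    rw [hrange y hy y' hy' h]
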